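/- arXiv:2107.14439 — 2 statements merged into one kernel-verified Lean document; each statement's English description precedes it below -/
import Mathlib

section
/- Every equivalence relation E in the class 𝔅 is not classifiable by countable structures. -/
open scoped ENNReal
open scoped Pointwise

/-- Borel reducibility of `E` to `F`. -/
def BorelReducible {X Y : Type} [MeasurableSpace X] [MeasurableSpace Y]
    (E : X → X → Prop) (F : Y → Y → Prop) : Prop :=
  ∃ φ : X → Y, Measurable φ ∧ ∀ x₁ x₂ : X, E x₁ x₂ ↔ F (φ x₁) (φ x₂)

/-- The Borel structure on `S_∞ = Equiv.Perm ℕ`, induced by `π ↦ (π, π⁻¹)` from the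
product `(ℕ → ℕ) × (ℕ → ℕ)`. -/
def permNatMS : MeasurableSpace (Equiv.Perm ℕ) :=
  MeasurableSpace.comap (fun π : Equiv.Perm ℕ => ((π : ℕ → ℕ), (π.symm : ℕ → ℕ))) inferInstance

/-- `E` is classifiable by countable structures: Borel reducible to the orbit
equivalence relation of a Borel action of `S_∞` on a standard Borel space. -/
def ClassifiableByCountableStructures {X : Type} [MeasurableSpace X] (E : X → X → Prop) : Prop :=
  ∃ (Y : Type) (_ : MeasurableSpace Y) (a : Equiv.Perm ℕ → Y → Y),
    StandardBorelSpace Y ∧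
    (∀ y : Y, a 1 y = y) ∧
    (∀ (π σ : Equiv.Perm ℕ) (y : Y), a (π * σ) y = a π (a σ y)) ∧
    (letI : MeasurableSpace (Equiv.Perm ℕ) := permNatMS;
      Measurable fun p : Equiv.Perm ℕ × Y => a p.1 p.2) ∧
    BorelReducible E fun y z : Y => ∃ π : Equiv.Perm ℕ, a π y = z

/-- A tall lower semicontinuous submeasure on `P(ℕ)`. -/
structure IsTallLscSubmeasure (Θ : Set ℕ → ℝ≥0∞) : Prop where
  empty : Θ ∅ = 0
  mono : ∀ M N : Set ℕ, M ⊆ N → Θ M ≤ Θ N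
  subadd : ∀ M N : Set ℕ, Θ (M ∪ N) ≤ Θ M + Θ N
  fin : ∀ m : ℕ, Θ {m} < ⊤
  lsc : ∀ M : Set ℕ,
    Filter.Tendsto (fun m : ℕ => Θ (M ∩ Set.Iio m)) Filter.atTop (nhds (Θ M))
  tall : Filter.Tendsto (fun m : ℕ => Θ {m}) Filter.atTop (nhds 0)

/-- The equivalence relation `E_Θ` on `2^ℕ` associated with the submeasure `Θ`. -/
def EsubTheta (Θ : Set ℕ → ℝ≥0∞) (x y : ℕ → Bool) : Prop :=
  Filter.Tendsto (fun m : ℕ => Θ {n : ℕ | m ≤ n ∧ x n ≠ y n}) Filter.atTop (nhds 0)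

/-- A non-trivial sequence of finite metric spaces: the diameters stay bounded away
from `0` while the minimal `ε` allowing an `ε`-chain through all points tends to `0`. -/
def NontrivialFMS (Z : ℕ → Type) [∀ m, MetricSpace (Z m)] [∀ m, Fintype (Z m)]
    [∀ m, Nonempty (Z m)] : Prop :=
  (0 < Filter.liminf (fun m : ℕ => ⨆ p : Z m × Z m, dist p.1 p.2) Filter.atTop) ∧
  ∀ ε : ℝ, 0 < ε → ∀ᶠ m in Filter.atTop, ∃ l : List (Z m),
    (∀ z : Z m, z ∈ l) ∧ l.Chain' (fun a b => dist a b < ε)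

/-- The equivalence relation `E_𝒵` on `∏ m, Z m`. -/
def EsubZ (Z : ℕ → Type) [∀ m, MetricSpace (Z m)] (x y : ∀ m, Z m) : Prop :=
  Filter.Tendsto (fun m : ℕ => dist (x m) (y m)) Filter.atTop (nhds 0)

section Work
open Filter Set Topology MeasureTheory

namespace CB

/-- The set of points around which `S` is everywhere non-meagre. -/
def env {Z : Type*} [TopologicalSpace Z] (S : Set Z) : Set Z :=
  {z | ∀ O : Set Z, IsOpen O → z ∈ O → ¬ IsMeagre (S ∩ O)}

lemma env_closed {Z : Type*} [TopologicalSpace Z] (S : Set Z) : IsClosed (env S) := by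
  rw [← isOpen_compl_iff, isOpen_iff_forall_mem_open]
  intro z hz
  simp only [env, mem_compl_iff, mem_setOf_eq, not_forall, not_not] at hz
  obtain ⟨O, hO, hzO, hm⟩ := hz
  refine ⟨O, fun y hy h => h O hO hy hm, hO, hzO⟩

lemma env_subset_closure {Z : Type*} [TopologicalSpace Z] (S : Set Z) : env S ⊆ closure S := by
  intro z hz
  rw [mem_closure_iff]
  intro O hO hzO
  have := nonempty_of_not_isMeagre (hz O hO hzO)
  rwa [inter_comm]

lemma diff_env_meagre {Z : Type*} [TopologicalSpace Z] [SecondCountableTopology Z] (S : Set Z) :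
    IsMeagre (S \ env S) := by
  have hB := TopologicalSpace.isBasis_countableBasis Z
  have hc := TopologicalSpace.countable_countableBasis Z
  have hm : IsMeagre (⋃ O ∈ {O ∈ TopologicalSpace.countableBasis Z | IsMeagre (S ∩ O)}, S ∩ O) := by
    apply isMeagre_biUnion
    · exact hc.mono (sep_subset _ _)
    · intro O hO; exact hO.2
  refine hm.mono ?_
  rintro z ⟨hzS, hz⟩
  simp only [env, mem_setOf_eq, not_forall, not_not] at hz
  obtain ⟨O, hO, hzO, hmO⟩ := hz
  obtain ⟨B, hBB, hzB, hBO⟩ := hB.exists_subset_of_mem_open hzO hO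
  simp only [mem_iUnion]
  exact ⟨B, ⟨hBB, hmO.mono (inter_subset_inter_right _ hBO)⟩, hzS, hzB⟩

lemma env_diff_meagre {Z : Type*} [TopologicalSpace Z] [SecondCountableTopology Z]
    (S : Set Z) (T : ℕ → Set Z) (h : S ⊆ ⋃ n, T n) :
    IsMeagre (env S \ ⋃ n, env (T n)) := by
  set D := env S \ ⋃ n, env (T n) with hD
  have hBM : BaireMeasurableSet D := by
    apply BaireMeasurableSet.diff
    · exact ((env_closed S).isOpen_compl.baireMeasurableSet).of_compl
    · exact BaireMeasurableSet.iUnion fun n =>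
        ((env_closed (T n)).isOpen_compl.baireMeasurableSet).of_compl
  obtain ⟨G, hG, hDG⟩ := hBM.residualEq_isOpen
  have h1 : IsMeagre (D \ G) := by
    have := hDG.mem_iff
    refine Filter.mem_of_superset this ?_
    rintro z hz ⟨h1, h2⟩; exact h2 (hz.1 h1)
  have h2 : IsMeagre (G \ D) := by
    have := hDG.mem_iff
    refine Filter.mem_of_superset this ?_
    rintro z hz ⟨h1, h2⟩; exact h2 (hz.2 h1)
  have h3 : IsMeagre (S ∩ G) := by
    have : IsMeagre ((⋃ n, (T n \ env (T n))) ∪ (G \ D)) :=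
      (isMeagre_iUnion fun n => diff_env_meagre (T n)).union h2
    refine this.mono ?_
    rintro z ⟨hzS, hzG⟩
    obtain ⟨n, hn⟩ := mem_iUnion.1 (h hzS)
    by_cases hz : z ∈ env (T n)
    · right; exact ⟨hzG, fun hd => hd.2 (mem_iUnion.2 ⟨n, hz⟩)⟩
    · left; exact mem_iUnion.2 ⟨n, hn, hz⟩
  refine h1.mono ?_
  intro z hz
  exact ⟨hz, fun hzG => hz.1 G hG hzG h3⟩

/-- Analytic sets have the Baire property. -/
theorem analytic_baire {Z : Type*} [TopologicalSpace Z] [SecondCountableTopology Z] [T2Space Z]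
    {A : Set Z} (hA : AnalyticSet A) : BaireMeasurableSet A := by
  rw [AnalyticSet] at hA
  rcases hA with rfl | ⟨f, hf, rfl⟩
  · exact isOpen_empty.baireMeasurableSet
  let N : List ℕ → Set (ℕ → ℕ) := fun s => {β | (List.range s.length).map β = s}
  have hN : ∀ s, f '' N s ⊆ ⋃ n, f '' N (s ++ [n]) := by
    rintro s _ ⟨β, hβ, rfl⟩
    refine mem_iUnion.2 ⟨β s.length, β, ?_, rfl⟩
    simp only [N, mem_setOf_eq] at hβ ⊢
    simp [List.range_succ, hβ]
  set M : Set Z := (range f \ env (range f)) ∪ ⋃ s, (env (f '' N s) \ ⋃ n, env (f '' N (s ++ [n])))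
    with hM
  have hMm : IsMeagre M :=
    (diff_env_meagre _).union (isMeagre_iUnion fun s => env_diff_meagre _ _ (hN s))
  have key : ∀ z, z ∉ M → z ∈ env (range f) → z ∈ range f := by
    intro z hzM hz
    have step : ∀ s : {s : List ℕ // z ∈ env (f '' N s)}, ∃ n, z ∈ env (f '' N (s.1 ++ [n])) := by
      rintro ⟨s, hs⟩
      by_contra hcon
      apply hzM
      right
      refine mem_iUnion.2 ⟨s, hs, ?_⟩
      simpa using hcon
    choose nx hnx using step
    have h0 : z ∈ env (f '' N []) := by
      have : N [] = univ := by ext; simp [N]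
      rwa [this, image_univ]
    let seq : ℕ → {s : List ℕ // z ∈ env (f '' N s)} := fun n =>
      Nat.rec ⟨[], h0⟩ (fun _ s => ⟨s.1 ++ [nx s], hnx s⟩) n
    have hseq : ∀ n, (seq (n+1)).1 = (seq n).1 ++ [nx (seq n)] := fun n => rfl
    let α : ℕ → ℕ := fun n => nx (seq n)
    have hα : ∀ n, (seq n).1 = (List.range n).map α := by
      intro n
      induction n with
      | zero => rfl
      | succ n ih => rw [hseq, ih, List.range_succ]; simp [α]
    refine ⟨α, ?_⟩
    by_contra hne
    obtain ⟨U, U', hU, hU', hfU, hzU', hd⟩ := t2_separation hne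
    have hopen : IsOpen (f ⁻¹' U) := hU.preimage hf
    have := (PiNat.isTopologicalBasis_cylinders (E := fun _ => ℕ)).exists_subset_of_mem_open
      (show α ∈ f ⁻¹' U from hfU) hopen
    obtain ⟨_, ⟨β, n, rfl⟩, hαc, hsub⟩ := this
    have hz' := env_subset_closure _ (seq n).2
    rw [mem_closure_iff] at hz'
    obtain ⟨_, hy1, γ, hγ, rfl⟩ := hz' U' hU' hzU'
    have hγc : γ ∈ PiNat.cylinder β n := by
      rw [PiNat.mem_cylinder_iff] at hαc ⊢
      intro i hi
      rw [← hαc i hi]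
      simp only [N, mem_setOf_eq, hα, List.length_map, List.length_range] at hγ
      have := List.map_inj_left.1 hγ i (List.mem_range.2 hi)
      exact this
    exact (disjoint_left.1 hd) (hsub hγc) hy1
  have : BaireMeasurableSet (env (range f)) :=
    ((env_closed _).isOpen_compl.baireMeasurableSet).of_compl
  refine this.congr ?_
  rw [Filter.eventuallyEq_set]
  refine Filter.mem_of_superset hMm ?_
  intro z hz
  refine ⟨key z hz, fun h => ?_⟩
  by_contra hcon
  exact hz (Or.inl ⟨h, hcon⟩)

/-- The easy direction of the Kuratowski-Ulam theorem. -/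
theorem kur_ulam {X Y : Type*} [TopologicalSpace X] [TopologicalSpace Y]
    [SecondCountableTopology Y] {A : Set (X × Y)} (hA : A ∈ residual (X × Y)) :
    ∀ᶠ x in residual X, ∀ᶠ y in residual Y, (x, y) ∈ A := by
  obtain ⟨S, hSo, hSd, hSc, hSA⟩ := mem_residual_iff.1 hA
  have h1 : ∀ D ∈ S, ∀ᶠ x in residual X, ∀ᶠ y in residual Y, (x, y) ∈ D := by
    intro D hD
    have hB := TopologicalSpace.isBasis_countableBasis Y
    have hc := TopologicalSpace.countable_countableBasis Y
    have : ∀ᶠ x in residual X, ∀ V ∈ TopologicalSpace.countableBasis Y, ∃ y ∈ V, (x, y) ∈ D := by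
      rw [eventually_countable_ball hc]
      intro V hV
      have hVo := hB.isOpen hV
      have hVne := TopologicalSpace.nonempty_of_mem_countableBasis hV
      have heq : {x | ∃ y ∈ V, (x, y) ∈ D} = Prod.fst '' (D ∩ (univ ×ˢ V)) := by
        ext x; constructor
        · rintro ⟨y, hy, hxy⟩; exact ⟨(x, y), ⟨hxy, trivial, hy⟩, rfl⟩
        · rintro ⟨⟨x', y⟩, ⟨h1, -, h2⟩, rfl⟩; exact ⟨y, h2, h1⟩
      apply residual_of_dense_open
      · rw [heq]
        exact isOpenMap_fst _ ((hSo D hD).inter (isOpen_univ.prod hVo))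
      · rw [dense_iff_inter_open]
        intro O hO hOne
        obtain ⟨⟨x, y⟩, ⟨hx, hy⟩, hxy⟩ := (hSd D hD).inter_open_nonempty (O ×ˢ V) (hO.prod hVo)
          (hOne.prod hVne)
        exact ⟨x, hx, y, hy, hxy⟩
    filter_upwards [this] with x hx
    apply residual_of_dense_open
    · exact (hSo D hD).preimage (Continuous.prodMk_right x)
    · rw [hB.dense_iff]
      intro V hV hVne
      obtain ⟨y, hy, hxy⟩ := hx V hV
      exact ⟨y, hy, hxy⟩
  have h2 := (eventually_countable_ball hSc).2 h1
  filter_upwards [h2] with x hx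
  have h3 := (eventually_countable_ball hSc).2 hx
  filter_upwards [h3] with y hy
  exact hSA (mem_sInter.2 hy)

/-- Updating one coordinate is an open map on a product of discrete spaces. -/
lemma isOpenMap_update {X : ℕ → Type*} [∀ j, TopologicalSpace (X j)] [∀ j, DiscreteTopology (X j)]
    (j : ℕ) (a : X j) : IsOpenMap (fun x : ∀ j, X j => Function.update x j a) := by
  intro O hO
  have : (fun x : ∀ j, X j => Function.update x j a) '' O
      = {y | y j = a} ∩ ⋃ b : X j, (fun y : ∀ j, X j => Function.update y j b) ⁻¹' O := by
    ext y
    simp only [mem_image, mem_inter_iff, mem_setOf_eq, mem_iUnion, mem_preimage]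
    constructor
    · rintro ⟨x, hx, rfl⟩
      refine ⟨by simp, x j, by simpa using hx⟩
    · rintro ⟨rfl, b, hb⟩
      exact ⟨_, hb, by simp⟩
  rw [this]
  apply IsOpen.inter
  · exact (isOpen_discrete {a}).preimage (continuous_apply j)
  · exact isOpen_iUnion fun b => hO.preimage (continuous_id.update j continuous_const)

lemma tendsto_update_residual {X : ℕ → Type*} [∀ j, TopologicalSpace (X j)]
    [∀ j, DiscreteTopology (X j)] (j : ℕ) (a : X j) :
    Tendsto (fun x : ∀ j, X j => Function.update x j a) (residual _) (residual _) :=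
  tendsto_residual_of_isOpenMap (continuous_id.update j continuous_const) (isOpenMap_update j a)

end CB

namespace CB

lemma local_generic {Z : Type*} [TopologicalSpace Z] [SecondCountableTopology Z] (P : Z → Prop) :
    ∀ᶠ z in residual Z,
      (∃ O : Set Z, IsOpen O ∧ z ∈ O ∧ ∀ᶠ y in residual Z, y ∈ O → P y) → P z := by
  have h := diff_env_meagre {z : Z | ¬ P z}
  refine Filter.mem_of_superset h ?_
  rintro z hz ⟨O, hO, hzO, hm⟩
  by_contra hP
  refine hz ⟨hP, fun henv => henv O hO hzO ?_⟩
  refine Filter.mem_of_superset hm ?_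
  rintro y hy ⟨h1, h2⟩
  exact h1 (hy h2)

lemma exists_dense_seq {Z : Type*} [TopologicalSpace Z] {R : Set Z} (hR : R ∈ residual Z) :
    ∃ D : ℕ → Set Z, (∀ k, IsOpen (D k)) ∧ (∀ k, Dense (D k)) ∧ ⋂ k, D k ⊆ R := by
  obtain ⟨S, hSo, hSd, hSc, hSR⟩ := mem_residual_iff.1 hR
  have hc : (insert univ S).Countable := hSc.insert _
  obtain ⟨D, hD⟩ := hc.exists_eq_range (insert_nonempty _ _)
  have hmem : ∀ k, D k ∈ insert univ S := fun k => hD ▸ mem_range_self k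
  refine ⟨D, fun k => ?_, fun k => ?_, ?_⟩
  · rcases hmem k with h | h
    · rw [h]; exact isOpen_univ
    · exact hSo _ h
  · rcases hmem k with h | h
    · rw [h]; exact dense_univ
    · exact hSd _ h
  · refine Subset.trans ?_ hSR
    intro z hz t ht
    have : t ∈ range D := hD ▸ mem_insert_of_mem _ ht
    obtain ⟨k, rfl⟩ := this
    exact mem_iInter.1 hz k

variable {X : ℕ → Type} [∀ j, TopologicalSpace (X j)] [∀ j, DiscreteTopology (X j)]
  [∀ j, Finite (X j)]
  {H : Type} [Group H] [TopologicalSpace H] [IsTopologicalGroup H] [PolishSpace H]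
  [MeasurableSpace H] [BorelSpace H]
  {Y : Type} [MeasurableSpace Y] [MulAction H Y]

/-- The second image lies in the orbit of the first image under elements of the set. -/
def Rel (φ : (∀ j, X j) → Y) (S : Subgroup H) (y y' : ∀ j, X j) : Prop :=
  ∃ g ∈ S, φ y' = g • φ y

lemma exists_cyl {X : ℕ → Type*} [∀ j, TopologicalSpace (X j)] [∀ j, DiscreteTopology (X j)]
    {O : Set (∀ j, X j)} (hO : IsOpen O) {x} (hx : x ∈ O) :
    ∃ N, PiNat.cylinder x N ⊆ O := by
  obtain ⟨_, ⟨y, n, rfl⟩, h1, h2⟩ :=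
    (PiNat.isTopologicalBasis_cylinders (E := X)).exists_subset_of_mem_open hx hO
  refine ⟨n, ?_⟩
  rw [PiNat.mem_cylinder_iff_eq] at h1
  rwa [h1]

lemma update_mem_cyl {X : ℕ → Type*} {x z : ∀ j, X j} {N j : ℕ} (hj : N ≤ j) (a : X j)
    (hz : z ∈ PiNat.cylinder x N) : Function.update z j a ∈ PiNat.cylinder x N := by
  rw [PiNat.mem_cylinder_iff] at hz ⊢
  intro i hi
  rw [Function.update_of_ne (by omega), hz i hi]

theorem lemmaA [Nonempty (∀ j, X j)] [MeasurableSpace (∀ j, X j)] [BorelSpace (∀ j, X j)]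
    (adj : ∀ j, X j → X j → Prop) (hrefl : ∀ j a, adj j a a) (hsymm : ∀ j a b, adj j a b → adj j b a)
    (m : Y → ℕ → Bool) (hm : Measurable m) (hmi : Function.Injective m)
    (hact : Measurable fun p : H × Y => p.1 • p.2)
    (φ : (∀ j, X j) → Y) (hφ : Measurable φ)
    (hE : ∀ x y : ∀ j, X j, (∀ j, adj j (x j) (y j)) → ∃ g : H, g • φ x = φ y)
    (S : Subgroup H) (hS : IsOpen (S : Set H))
    (O : Set (∀ j, X j)) (hO : IsOpen O) (hOne : O.Nonempty) :
    ∃ x N, PiNat.cylinder x N ⊆ O ∧ ∀ j, N ≤ j → ∀ a b, adj j a b →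
      ∀ᶠ z in residual (∀ j, X j), z ∈ PiNat.cylinder x N →
        Rel φ S (Function.update z j a) (Function.update z j b) := by
  classical
  let K : ℕ → Type := fun j => {f : X j → X j // ∀ a, adj j a (f a)}
  let _ : ∀ j, TopologicalSpace (K j) := fun j => ⊥
  have _ : ∀ j, DiscreteTopology (K j) := fun j => ⟨rfl⟩
  have _ : ∀ j, Finite (K j) := fun j => Subtype.finite
  let k1 : ∀ j, K j := fun j => ⟨id, fun a => hrefl j a⟩
  let act : (∀ j, X j) × (∀ j, K j) → ∀ j, X j := fun p j => (p.2 j).1 (p.1 j)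
  have hactc : Continuous act := by
    refine continuous_pi fun j => ?_
    have h1 : Continuous (fun q : X j × K j => q.2.1 q.1) := continuous_of_discreteTopology
    exact h1.comp (((continuous_apply j).comp continuous_fst).prodMk
      ((continuous_apply j).comp continuous_snd))
  borelize (∀ j, K j)
  let d := TopologicalSpace.denseSeq H
  let B : ℕ → Set ((∀ j, X j) × (∀ j, K j)) := fun i =>
    {p | ∃ h : H, h * (d i)⁻¹ ∈ S ∧ h • φ (act p) = φ p.1}
  have hBan : ∀ i, AnalyticSet (B i) := by
    intro i
    have hms : MeasurableSet {q : ((∀ j, X j) × (∀ j, K j)) × H |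
        q.2 * (d i)⁻¹ ∈ S ∧ q.2 • φ (act q.1) = φ q.1.1} := by
      apply MeasurableSet.inter
      · have : IsOpen {q : ((∀ j, X j) × (∀ j, K j)) × H | q.2 * (d i)⁻¹ ∈ S} :=
          hS.preimage (continuous_snd.mul continuous_const)
        exact this.measurableSet
      · have h1 : Measurable fun q : ((∀ j, X j) × (∀ j, K j)) × H => m (q.2 • φ (act q.1)) := by
          refine hm.comp (hact.comp (measurable_snd.prodMk (hφ.comp ?_)))
          exact hactc.measurable.comp measurable_fst
        have h2 : Measurable fun q : ((∀ j, X j) × (∀ j, K j)) × H => m (φ q.1.1) :=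
          hm.comp (hφ.comp (measurable_fst.comp measurable_fst))
        have h3 := measurableSet_eq_fun h1 h2
        simp only [hmi.eq_iff] at h3
        exact h3
    have := hms.analyticSet_image (measurable_fst)
    convert this using 1
    ext p
    constructor
    · rintro ⟨h, hh⟩; exact ⟨(p, h), hh, rfl⟩
    · rintro ⟨⟨p', h⟩, hh, rfl⟩; exact ⟨h, hh⟩
  have hcov : ∀ p, ∃ i, p ∈ B i := by
    intro p
    obtain ⟨g, hg⟩ := hE (act p) p.1 (fun j => hsymm _ _ _ ((p.2 j).2 (p.1 j)))
    have hop : IsOpen {h : H | g * h⁻¹ ∈ S} := hS.preimage (continuous_const.mul continuous_inv)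
    obtain ⟨_, hx, i, rfl⟩ := (TopologicalSpace.denseRange_denseSeq H).inter_open_nonempty _ hop
      ⟨g, by simp [S.one_mem]⟩
    exact ⟨i, g, hx, hg⟩
  choose G hG hBG using fun i => (analytic_baire (hBan i)).residualEq_isOpen
  have hR : ∀ᶠ p in residual ((∀ j, X j) × (∀ j, K j)), ∀ i, (p ∈ B i ↔ p ∈ G i) :=
    eventually_countable_forall.2 fun i => (hBG i).mem_iff
  obtain ⟨⟨x0, k0⟩, ⟨hx0, -⟩, hp0⟩ := (dense_of_mem_residual hR).inter_open_nonempty (O ×ˢ univ)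
    (hO.prod isOpen_univ) (hOne.prod ⟨k1, trivial⟩)
  obtain ⟨i, hi⟩ := hcov (x0, k0)
  have hiG : (x0, k0) ∈ G i := (hp0 i).1 hi
  obtain ⟨u, v, hu, hv, hxu, hkv, huv⟩ := isOpen_prod_iff.1 (hG i) x0 k0 hiG
  obtain ⟨N1, hN1⟩ := exists_cyl (hu.inter hO) ⟨hxu, hx0⟩
  obtain ⟨N2, hN2⟩ := exists_cyl hv hkv
  have hR' := kur_ulam hR
  refine ⟨x0, max N1 N2, ?_, ?_⟩
  · exact (PiNat.cylinder_anti x0 (le_max_left _ _)).trans (hN1.trans inter_subset_right)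
  intro j hj a b hab
  have e1 := (tendsto_update_residual j a).eventually hR'
  have e2 := (tendsto_update_residual j b).eventually hR'
  filter_upwards [e1, e2] with z hz1 hz2 hz
  let τ : K j := ⟨fun c => if c = b then a else c, fun c => by
    by_cases hc : c = b
    · subst hc; simpa using hsymm _ _ _ hab
    · simpa [hc] using hrefl j c⟩
  have f1 := (tendsto_update_residual j (k1 j)).eventually hz1
  have f2 := (tendsto_update_residual j τ).eventually hz2
  obtain ⟨k, hk, hk1, hk2⟩ := (dense_of_mem_residual (f1.and f2)).inter_open_nonempty
    (PiNat.cylinder k0 (max N1 N2)) (PiNat.isOpen_cylinder _ _ _) ⟨k0, PiNat.self_mem_cylinder _ _⟩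
  have hGmem : ∀ (c : X j) (σ : K j),
      (Function.update z j c, Function.update k j σ) ∈ G i := by
    intro c σ
    refine huv ⟨(hN1 ?_).1, hN2 ?_⟩
    · exact PiNat.cylinder_anti x0 (le_max_left _ _) (update_mem_cyl hj c hz)
    · exact PiNat.cylinder_anti k0 (le_max_right _ _) (update_mem_cyl hj σ hk)
  obtain ⟨h1, hh1, hh1'⟩ := (hk1 i).2 (hGmem _ _)
  obtain ⟨h2, hh2, hh2'⟩ := (hk2 i).2 (hGmem _ _)
  have hacteq : act (Function.update z j a, Function.update k j (k1 j))
      = act (Function.update z j b, Function.update k j τ) := by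
    funext l
    by_cases hl : l = j
    · subst hl
      simp [act, k1, τ]
    · simp [act, hl]
  rw [hacteq] at hh1'
  refine ⟨h2 * h1⁻¹, ?_, ?_⟩
  · have := S.mul_mem hh2 (S.inv_mem hh1)
    simpa using this
  · simp only at hh1' hh2'
    rw [← hh1', ← hh2', mul_smul, inv_smul_smul]

end CB

namespace CB

variable {X : ℕ → Type} [∀ j, TopologicalSpace (X j)] [∀ j, DiscreteTopology (X j)]
  [∀ j, Finite (X j)]
  {H : Type} [Group H] [TopologicalSpace H] [IsTopologicalGroup H] [PolishSpace H]
  [MeasurableSpace H] [BorelSpace H]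
  {Y : Type} [MeasurableSpace Y] [MulAction H Y]

/-- All single-coordinate adjacent moves beyond `N` inside the cylinder of `x` stay in `S`-orbits. -/
def Good (adj : ∀ j, X j → X j → Prop) (φ : (∀ j, X j) → Y) (C : Set (∀ j, X j)) (S : Subgroup H)
    (x : ∀ j, X j) (N : ℕ) : Prop :=
  ∀ z ∈ C, z ∈ PiNat.cylinder x N → ∀ j, N ≤ j → ∀ a b, adj j a b →
    Rel φ S (Function.update z j a) (Function.update z j b)

lemma closeUp (C0 : Set (∀ j, X j)) (h0 : C0 ∈ residual (∀ j, X j)) :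
    ∃ C ⊆ C0, C ∈ residual (∀ j, X j) ∧ ∀ x ∈ C, ∀ j (a : X j), Function.update x j a ∈ C := by
  let ap : List (Σ j, X j) → (∀ j, X j) → (∀ j, X j) := fun l x =>
    l.foldl (fun x p => Function.update x p.1 p.2) x
  refine ⟨{x | ∀ l, ap l x ∈ C0}, fun x hx => hx [], ?_, fun x hx j a l => hx (⟨j, a⟩ :: l)⟩
  have : ∀ᶠ x in residual (∀ j, X j), ∀ l, ap l x ∈ C0 := by
    rw [eventually_countable_forall]
    intro l
    have : Tendsto (ap l) (residual _) (residual _) := by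
      induction l with
      | nil => exact tendsto_id
      | cons p l ih => exact ih.comp (tendsto_update_residual p.1 p.2)
    exact this.eventually h0
  exact this

theorem lemmaB [Nonempty (∀ j, X j)] [MeasurableSpace (∀ j, X j)] [BorelSpace (∀ j, X j)]
    (adj : ∀ j, X j → X j → Prop) (hrefl : ∀ j a, adj j a a) (hsymm : ∀ j a b, adj j a b → adj j b a)
    (m : Y → ℕ → Bool) (hm : Measurable m) (hmi : Function.Injective m)
    (hact : Measurable fun p : H × Y => p.1 • p.2)
    (φ : (∀ j, X j) → Y) (hφ : Measurable φ)
    (hE : ∀ x y : ∀ j, X j, (∀ j, adj j (x j) (y j)) → ∃ g : H, g • φ x = φ y)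
    {ι : Type} [Countable ι] (S : ι → Subgroup H) (hS : ∀ i, IsOpen (S i : Set H)) :
    ∃ (C : Set (∀ j, X j)) (O : ℕ → Bool → Set ((∀ j, X j) × H)), C ∈ residual (∀ j, X j) ∧
      (∀ i b, IsOpen (O i b)) ∧
      (∀ x ∈ C, ∀ j (a : X j), Function.update x j a ∈ C) ∧
      (∀ x ∈ C, ∀ᶠ h in residual H, ∀ i b, (m (h • φ x) i = b ↔ (x, h) ∈ O i b)) ∧
      (∀ x ∈ C, ∀ i, ∃ N, Good adj φ C (S i) x N) := by
  have hBP : ∀ i b, ∃ u : Set ((∀ j, X j) × H), IsOpen u ∧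
      {p : (∀ j, X j) × H | m (p.2 • φ p.1) i = b} =ᶠ[residual _] u := by
    intro i b
    have h1 : Measurable fun p : (∀ j, X j) × H => m (p.2 • φ p.1) i :=
      (measurable_pi_apply i).comp (hm.comp (hact.comp
        (measurable_snd.prodMk (hφ.comp measurable_fst))))
    exact (h1 (measurableSet_singleton b)).residualEq_isOpen
  choose O hO hOeq using hBP
  have c1 : ∀ᶠ x in residual (∀ j, X j), ∀ᶠ h in residual H,
      ∀ i b, (m (h • φ x) i = b ↔ (x, h) ∈ O i b) := by
    apply kur_ulam (A := {p : (∀ j, X j) × H | ∀ i b, (m (p.2 • φ p.1) i = b ↔ p ∈ O i b)})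
    have : ∀ᶠ p in residual ((∀ j, X j) × H), ∀ i b, (m (p.2 • φ p.1) i = b ↔ p ∈ O i b) := by
      simp only [eventually_countable_forall]
      intro i b
      exact (hOeq i b).mem_iff
    exact this
  have c2 : ∀ᶠ x in residual (∀ j, X j), ∀ i, ∃ N, ∀ j, N ≤ j → ∀ a b, adj j a b →
      ∀ᶠ z in residual (∀ j, X j), z ∈ PiNat.cylinder x N →
        Rel φ (S i) (Function.update z j a) (Function.update z j b) := by
    rw [eventually_countable_forall]
    intro i
    apply residual_of_dense_open
    · rw [isOpen_iff_forall_mem_open]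
      rintro x ⟨N, hN⟩
      refine ⟨PiNat.cylinder x N, ?_, PiNat.isOpen_cylinder _ _ _, PiNat.self_mem_cylinder _ _⟩
      intro x' hx'
      refine ⟨N, ?_⟩
      rw [PiNat.mem_cylinder_iff_eq] at hx'
      rw [hx']
      exact hN
    · rw [dense_iff_inter_open]
      intro W hW hWne
      obtain ⟨x, N, h1, h2⟩ := lemmaA adj hrefl hsymm m hm hmi hact φ hφ hE (S i) (hS i) W hW hWne
      exact ⟨x, h1 (PiNat.self_mem_cylinder _ _), N, h2⟩
  have c3 : ∀ᶠ x in residual (∀ j, X j), ∀ (i : ι) (j : ℕ) (a b : X j),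
      (∃ W : Set (∀ j, X j), IsOpen W ∧ x ∈ W ∧ ∀ᶠ y in residual (∀ j, X j), y ∈ W →
        Rel φ (S i) (Function.update y j a) (Function.update y j b)) →
        Rel φ (S i) (Function.update x j a) (Function.update x j b) := by
    simp only [eventually_countable_forall]
    intro i j a b
    exact local_generic (fun x => Rel φ (S i) (Function.update x j a) (Function.update x j b))
  obtain ⟨C, hC0, hCr, hCu⟩ := closeUp _ ((c1.and c2).and c3)
  refine ⟨C, O, hCr, hO, hCu, fun x hx => (hC0 hx).1.1, ?_⟩
  intro x hx i
  obtain ⟨N, hN⟩ := (hC0 hx).1.2 i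
  refine ⟨N, ?_⟩
  intro z hz hzc j hj a b hab
  exact (hC0 hz).2 i j a b ⟨_, PiNat.isOpen_cylinder _ x N, hzc, hN j hj a b hab⟩

lemma Rel.refl (φ : (∀ j, X j) → Y) (S : Subgroup H) (x : ∀ j, X j) : Rel φ S x x :=
  ⟨1, S.one_mem, by simp⟩

lemma Rel.trans {φ : (∀ j, X j) → Y} {S : Subgroup H} {x y z : ∀ j, X j} (h1 : Rel φ S x y)
    (h2 : Rel φ S y z) : Rel φ S x z := by
  obtain ⟨g, hg, e⟩ := h1
  obtain ⟨g', hg', e'⟩ := h2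
  exact ⟨g' * g, S.mul_mem hg' hg, by rw [e', e, mul_smul]⟩

lemma move {adj : ∀ j, X j → X j → Prop} (hconn : ∀ j a b, Relation.ReflTransGen (adj j) a b)
    {φ : (∀ j, X j) → Y} {C : Set (∀ j, X j)}
    (hC : ∀ x ∈ C, ∀ j (a : X j), Function.update x j a ∈ C)
    {S : Subgroup H} {x y : ∀ j, X j} {N : ℕ} (hg : Good adj φ C S x N)
    (hy : y ∈ C) (hyx : y ∈ PiNat.cylinder x N) (M : ℕ) :
    ∃ y' ∈ C, y' ∈ PiNat.cylinder x M ∧ y' ∈ PiNat.cylinder x N ∧ Rel φ S y y' := by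
  induction M with
  | zero => exact ⟨y, hy, by simp, hyx, Rel.refl _ _ _⟩
  | succ M ih =>
    obtain ⟨y', hy'C, h1, h2, h3⟩ := ih
    by_cases hMN : M < N
    · refine ⟨y', hy'C, ?_, h2, h3⟩
      rw [PiNat.mem_cylinder_iff] at h2 ⊢
      intro i hi; exact h2 i (by omega)
    · push Not at hMN
      have key : ∀ c, Relation.ReflTransGen (adj M) (y' M) c →
          Rel φ S y' (Function.update y' M c) := by
        intro c hc
        induction hc with
        | refl => simpa using Rel.refl φ S y'
        | tail _ hbc ih2 => exact ih2.trans (hg y' hy'C h2 M hMN _ _ hbc)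
      refine ⟨Function.update y' M (x M), hC _ hy'C _ _, ?_, update_mem_cyl hMN _ h2,
        h3.trans (key _ (hconn _ _ _))⟩
      rw [PiNat.mem_cylinder_iff] at h1 ⊢
      intro i hi
      by_cases hiM : i = M
      · subst hiM; simp
      · rw [Function.update_of_ne hiM]; exact h1 i (by omega)

end CB

namespace CB

variable {X : ℕ → Type} [∀ j, TopologicalSpace (X j)] [∀ j, DiscreteTopology (X j)]
  [∀ j, Finite (X j)]
  {H : Type} [Group H] [TopologicalSpace H] [IsTopologicalGroup H] [PolishSpace H]
  [MeasurableSpace H] [BorelSpace H]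
  {Y : Type} [MeasurableSpace Y] [MulAction H Y]

/-- The right coset `V n * d m`. -/
def cos (V : ℕ → Subgroup H) (d : ℕ → H) (n k : ℕ) : Set H := {h | h * (d k)⁻¹ ∈ V n}

/-- The right stabilizer of the coset `V n * d m`. -/
def stab (V : ℕ → Subgroup H) (d : ℕ → H) (p : ℕ × ℕ) : Subgroup H :=
  (V p.1).comap (MulAut.conj (d p.2)).toMonoidHom

lemma mem_stab (V : ℕ → Subgroup H) (d : ℕ → H) (p : ℕ × ℕ) (w : H) :
    w ∈ stab V d p ↔ d p.2 * w * (d p.2)⁻¹ ∈ V p.1 := by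
  simp [stab, Subgroup.mem_comap]

lemma cos_mul (V : ℕ → Subgroup H) (d : ℕ → H) {n k : ℕ} {h w : H} (hh : h ∈ cos V d n k)
    (hw : w ∈ stab V d (n, k)) : h * w ∈ cos V d n k := by
  rw [mem_stab] at hw
  have := (V n).mul_mem hh hw
  simp only [cos, mem_ofPred_eq]
  convert this using 1
  group

lemma stab_open (V : ℕ → Subgroup H) (hV : ∀ n, IsOpen (V n : Set H)) (d : ℕ → H) (p : ℕ × ℕ) :
    IsOpen (stab V d p : Set H) := by
  have : (stab V d p : Set H) = (fun w => d p.2 * w * (d p.2)⁻¹) ⁻¹' (V p.1 : Set H) := by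
    ext w; exact mem_stab V d p w
  rw [this]
  exact (hV _).preimage (by fun_prop)

lemma cos_open (V : ℕ → Subgroup H) (hV : ∀ n, IsOpen (V n : Set H)) (d : ℕ → H) (n k : ℕ) :
    IsOpen (cos V d n k) :=
  (hV n).preimage (continuous_id.mul continuous_const)

lemma cos_closed (V : ℕ → Subgroup H) (hV : ∀ n, IsOpen (V n : Set H)) (d : ℕ → H) (n k : ℕ) :
    IsClosed (cos V d n k) :=
  ((V n).isClosed_of_isOpen (hV n)).preimage (continuous_id.mul continuous_const)

lemma exists_cos (V : ℕ → Subgroup H) (hV : ∀ n, IsOpen (V n : Set H))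
    (hbas : ∀ W ∈ 𝓝 (1 : H), ∃ n, (V n : Set H) ⊆ W) (d : ℕ → H) (hd : DenseRange d)
    {W : Set H} (hW : IsOpen W) {h : H} (hh : h ∈ W) :
    ∃ n k, h ∈ cos V d n k ∧ cos V d n k ⊆ W := by
  have h1 : (fun u => u * h) ⁻¹' W ∈ 𝓝 (1 : H) :=
    (hW.preimage (continuous_id.mul continuous_const)).mem_nhds (by simpa using hh)
  obtain ⟨n, hn⟩ := hbas _ h1
  have hop : IsOpen {u : H | h * u⁻¹ ∈ V n} := (hV n).preimage (continuous_const.mul continuous_inv)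
  obtain ⟨_, hx, k, rfl⟩ := hd.inter_open_nonempty _ hop ⟨h, by simp [(V n).one_mem]⟩
  refine ⟨n, k, hx, ?_⟩
  intro u hu
  have := hn ((V n).mul_mem hu ((V n).inv_mem hx))
  simpa using this

/-- A position in the back-and-forth construction. -/
structure State (adj : ∀ j, X j → X j → Prop) (φ : (∀ j, X j) → Y) (C : Set (∀ j, X j))
    (V : ℕ → Subgroup H) (d : ℕ → H) (x0 y0 : ∀ j, X j) where
  x : ∀ j, X j
  y : ∀ j, X j
  g : H
  g' : H
  n : ℕ
  k : ℕ
  N : ℕ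
  hx : x ∈ C
  hy : y ∈ C
  hg : φ x = g • φ x0
  hg' : φ y = g' • φ y0
  hyx : y ∈ PiNat.cylinder x N
  good : Good adj φ C (stab V d (n, k)) x N

/-- The coset attached to the first point. -/
def State.W {adj : ∀ j, X j → X j → Prop} {φ : (∀ j, X j) → Y} {C : Set (∀ j, X j)}
    {V : ℕ → Subgroup H} {d : ℕ → H} {x0 y0 : ∀ j, X j} (s : State adj φ C V d x0 y0) : Set H :=
  {h | h * s.g⁻¹ ∈ cos V d s.n s.k}

/-- The coset attached to the second point. -/
def State.W' {adj : ∀ j, X j → X j → Prop} {φ : (∀ j, X j) → Y} {C : Set (∀ j, X j)}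
    {V : ℕ → Subgroup H} {d : ℕ → H} {x0 y0 : ∀ j, X j} (s : State adj φ C V d x0 y0) : Set H :=
  {h | h * s.g'⁻¹ ∈ cos V d s.n s.k}

/-- Exchange the two points. -/
def State.swap {adj : ∀ j, X j → X j → Prop} {φ : (∀ j, X j) → Y} {C : Set (∀ j, X j)}
    {V : ℕ → Subgroup H} {d : ℕ → H} {x0 y0 : ∀ j, X j} (s : State adj φ C V d x0 y0) :
    State adj φ C V d y0 x0 where
  x := s.y
  y := s.x
  g := s.g'
  g' := s.g
  n := s.n
  k := s.k
  N := s.N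
  hx := s.hy
  hy := s.hx
  hg := s.hg'
  hg' := s.hg
  hyx := by
    rw [PiNat.mem_cylinder_comm]; exact s.hyx
  good := by
    have := s.hyx
    rw [PiNat.mem_cylinder_iff_eq] at this
    intro z hz hzc
    rw [this] at hzc
    exact s.good z hz hzc

lemma tendsto_mul_residual (g : H) : Tendsto (fun h : H => h * g) (residual H) (residual H) :=
  tendsto_residual_of_isOpenMap (Homeomorph.mulRight g).continuous (Homeomorph.mulRight g).isOpenMap

theorem half_step (adj : ∀ j, X j → X j → Prop)
    (hconn : ∀ j a b, Relation.ReflTransGen (adj j) a b)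
    (m : Y → ℕ → Bool) (φ : (∀ j, X j) → Y) (C : Set (∀ j, X j))
    (V : ℕ → Subgroup H) (hV : ∀ n, IsOpen (V n : Set H))
    (hbas : ∀ W ∈ 𝓝 (1 : H), ∃ n, (V n : Set H) ⊆ W) (d : ℕ → H) (hd : DenseRange d)
    (O : ℕ → Bool → Set ((∀ j, X j) × H)) (hO : ∀ i b, IsOpen (O i b))
    (hC : ∀ x ∈ C, ∀ j (a : X j), Function.update x j a ∈ C)
    (hC1 : ∀ x ∈ C, ∀ᶠ h in residual H, ∀ i b, (m (h • φ x) i = b ↔ (x, h) ∈ O i b))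
    (hC2 : ∀ x ∈ C, ∀ p, ∃ N, Good adj φ C (stab V d p) x N)
    (x0 y0 : ∀ j, X j) (s : State adj φ C V d x0 y0) (i : ℕ)
    (Q : Set H → Prop) (hQm : ∀ A B, A ⊆ B → Q B → Q A)
    (hQ : ∀ A, IsOpen A → A.Nonempty → ∃ B ⊆ A, IsOpen B ∧ B.Nonempty ∧ Q B) :
    ∃ s' : State adj φ C V d x0 y0, s'.W ⊆ s.W ∧ s'.W' ⊆ s.W' ∧ Q s'.W ∧
      ∃ b, (∀ᶠ h in residual H, h ∈ s'.W → m (h • φ x0) i = b) ∧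
        (∀ᶠ h in residual H, h ∈ s'.W' → m (h • φ y0) i = b) := by
  have hWo : IsOpen s.W := (cos_open V hV d s.n s.k).preimage (continuous_id.mul continuous_const)
  have hWne : s.W.Nonempty := ⟨d s.k * s.g, by simp [State.W, cos, (V s.n).one_mem]⟩
  obtain ⟨A, hAW, hAo, hAne, hQA⟩ := hQ _ hWo hWne
  have hA'o : IsOpen {u : H | u * s.g ∈ A} := hAo.preimage (continuous_id.mul continuous_const)
  have hA'ne : {u : H | u * s.g ∈ A}.Nonempty := by
    obtain ⟨a, ha⟩ := hAne
    exact ⟨a * s.g⁻¹, by simpa using ha⟩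
  obtain ⟨h, hhA, hh⟩ := (dense_of_mem_residual (hC1 _ s.hx)).inter_open_nonempty _ hA'o hA'ne
  set b := m (h • φ s.x) i with hb
  have hhO : (s.x, h) ∈ O i b := (hh i b).1 rfl
  obtain ⟨u, v, hu, hv, hxu, hhv, huv⟩ := isOpen_prod_iff.1 (hO i b) _ _ hhO
  obtain ⟨N1, hN1⟩ := exists_cyl hu hxu
  obtain ⟨n1, k1, hhc, hcsub⟩ := exists_cos V hV hbas d hd (hv.inter hA'o) ⟨hhv, hhA⟩
  obtain ⟨N2, hN2⟩ := hC2 _ s.hx (n1, k1)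
  obtain ⟨y1, hy1C, hy1M, hy1N, w, hw, hwe⟩ := move hconn hC s.good s.hy s.hyx (max N1 N2)
  let s' : State adj φ C V d x0 y0 :=
    { x := s.x
      y := y1
      g := s.g
      g' := w * s.g'
      n := n1
      k := k1
      N := max N1 N2
      hx := s.hx
      hy := hy1C
      hg := s.hg
      hg' := by rw [hwe, s.hg', mul_smul]
      hyx := hy1M
      good := by
        intro z hz hzc j hj a c hac
        exact hN2 z hz (PiNat.cylinder_anti _ (le_max_right _ _) hzc) j
          ((le_max_right _ _).trans hj) a c hac }
  have hW : s'.W ⊆ A := by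
    intro t ht
    have := (hcsub ht).2
    simpa [s'] using this
  have forced : ∀ z ∈ C, z ∈ PiNat.cylinder s.x (max N1 N2) → ∀ (γ : H) (z0 : ∀ j, X j),
      φ z = γ • φ z0 → ∀ᶠ t in residual H, t * γ⁻¹ ∈ cos V d n1 k1 → m (t • φ z0) i = b := by
    intro z hz hzc γ z0 hγ
    filter_upwards [(tendsto_mul_residual γ⁻¹).eventually (hC1 z hz)] with t ht htc
    have h1 : (z, t * γ⁻¹) ∈ O i b :=
      huv ⟨hN1 (PiNat.cylinder_anti _ (le_max_left _ _) hzc), (hcsub htc).1⟩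
    have h2 := (ht i b).2 h1
    rwa [hγ, mul_smul, inv_smul_smul] at h2
  refine ⟨s', hW.trans hAW, ?_, hQm _ _ hW hQA, b, ?_, ?_⟩
  · intro t ht
    have h1 : t * (w * s.g')⁻¹ ∈ cos V d n1 k1 := ht
    have h2 : t * (w * s.g')⁻¹ ∈ cos V d s.n s.k := by
      have := hAW (hcsub h1).2
      simpa [State.W] using this
    have h3 := cos_mul V d h2 hw
    have e : t * (w * s.g')⁻¹ * w = t * s.g'⁻¹ := by group
    rw [e] at h3
    exact h3
  · exact forced s.x s.hx (PiNat.self_mem_cylinder _ _) s.g x0 s.hg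
  · exact forced y1 hy1C hy1M (w * s.g') y0 s'.hg'

theorem full_step (adj : ∀ j, X j → X j → Prop)
    (hconn : ∀ j a b, Relation.ReflTransGen (adj j) a b)
    (m : Y → ℕ → Bool) (φ : (∀ j, X j) → Y) (C : Set (∀ j, X j))
    (V : ℕ → Subgroup H) (hV : ∀ n, IsOpen (V n : Set H))
    (hbas : ∀ W ∈ 𝓝 (1 : H), ∃ n, (V n : Set H) ⊆ W) (d : ℕ → H) (hd : DenseRange d)
    (O : ℕ → Bool → Set ((∀ j, X j) × H)) (hO : ∀ i b, IsOpen (O i b))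
    (hC : ∀ x ∈ C, ∀ j (a : X j), Function.update x j a ∈ C)
    (hC1 : ∀ x ∈ C, ∀ᶠ h in residual H, ∀ i b, (m (h • φ x) i = b ↔ (x, h) ∈ O i b))
    (hC2 : ∀ x ∈ C, ∀ p, ∃ N, Good adj φ C (stab V d p) x N)
    (x0 y0 : ∀ j, X j) (s : State adj φ C V d x0 y0) (i : ℕ)
    (Q : Set H → Prop) (hQm : ∀ A B, A ⊆ B → Q B → Q A)
    (hQ : ∀ A, IsOpen A → A.Nonempty → ∃ B ⊆ A, IsOpen B ∧ B.Nonempty ∧ Q B)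
    (Q' : Set H → Prop) (hQm' : ∀ A B, A ⊆ B → Q' B → Q' A)
    (hQ' : ∀ A, IsOpen A → A.Nonempty → ∃ B ⊆ A, IsOpen B ∧ B.Nonempty ∧ Q' B) :
    ∃ s' : State adj φ C V d x0 y0, s'.W ⊆ s.W ∧ s'.W' ⊆ s.W' ∧ Q s'.W ∧ Q' s'.W' ∧
      ∃ b, (∀ᶠ h in residual H, h ∈ s'.W → m (h • φ x0) i = b) ∧
        (∀ᶠ h in residual H, h ∈ s'.W' → m (h • φ y0) i = b) := by
  obtain ⟨s1, a1, a2, a3, b, a4, a5⟩ := half_step adj hconn m φ C V hV hbas d hd O hO hC hC1 hC2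
    x0 y0 s i Q hQm hQ
  obtain ⟨s2, b1, b2, b3, -⟩ := half_step adj hconn m φ C V hV hbas d hd O hO hC hC1 hC2
    y0 x0 s1.swap i Q' hQm' hQ'
  have b1' : s2.swap.W' ⊆ s1.W' := b1
  have b2' : s2.swap.W ⊆ s1.W := b2
  refine ⟨s2.swap, b2'.trans a1, b1'.trans a2, hQm _ _ b2' a3, b3, b, ?_, ?_⟩
  · filter_upwards [a4] with h hh hm using hh (b2' hm)
  · filter_upwards [a5] with h hh hm using hh (b1' hm)

theorem fusion (adj : ∀ j, X j → X j → Prop)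
    (hconn : ∀ j a b, Relation.ReflTransGen (adj j) a b)
    (m : Y → ℕ → Bool) (hmi : Function.Injective m) (φ : (∀ j, X j) → Y) (C : Set (∀ j, X j))
    (V : ℕ → Subgroup H) (hV : ∀ n, IsOpen (V n : Set H)) (hV0 : V 0 = ⊤)
    (hbas : ∀ W ∈ 𝓝 (1 : H), ∃ n, (V n : Set H) ⊆ W) (d : ℕ → H) (hd : DenseRange d)
    (O : ℕ → Bool → Set ((∀ j, X j) × H)) (hO : ∀ i b, IsOpen (O i b))
    (hC : ∀ x ∈ C, ∀ j (a : X j), Function.update x j a ∈ C)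
    (hC1 : ∀ x ∈ C, ∀ᶠ h in residual H, ∀ i b, (m (h • φ x) i = b ↔ (x, h) ∈ O i b))
    (hC2 : ∀ x ∈ C, ∀ p, ∃ N, Good adj φ C (stab V d p) x N)
    (hupd : ∀ (z : ∀ j, X j) (j : ℕ) (a b : X j), adj j a b →
      ∃ g : H, φ (Function.update z j b) = g • φ (Function.update z j a))
    (x0 y0 : ∀ j, X j) (hx0 : x0 ∈ C) (hy0 : y0 ∈ C) :
    ∃ g : H, g • φ x0 = φ y0 := by
  letI := TopologicalSpace.upgradeIsCompletelyMetrizable H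
  have gen : ∀ z0 : ∀ j, X j, ∃ D : ℕ → Set H, (∀ k, IsOpen (D k)) ∧ (∀ k, Dense (D k)) ∧
      ∀ h ∈ ⋂ k, D k, ∀ i b, (∃ W : Set H, IsOpen W ∧ h ∈ W ∧
        ∀ᶠ t in residual H, t ∈ W → m (t • φ z0) i = b) → m (h • φ z0) i = b := by
    intro z0
    have hr : ∀ᶠ h in residual H, ∀ i b, (∃ W : Set H, IsOpen W ∧ h ∈ W ∧
        ∀ᶠ t in residual H, t ∈ W → m (t • φ z0) i = b) → m (h • φ z0) i = b := by
      simp only [eventually_countable_forall]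
      intro i b
      exact local_generic (fun h => m (h • φ z0) i = b)
    obtain ⟨D, h1, h2, h3⟩ := exists_dense_seq hr
    exact ⟨D, h1, h2, h3⟩
  obtain ⟨D, hDo, hDd, hDg⟩ := gen x0
  obtain ⟨D', hDo', hDd', hDg'⟩ := gen y0
  let Q : (ℕ → Set H) → ℕ → Set H → Prop := fun D k A =>
    A ⊆ D k ∧ ∃ c, A ⊆ Metric.ball c ((1/2 : ℝ)^k)
  have hQm : ∀ D k A B, A ⊆ B → Q D k B → Q D k A := by
    rintro D k A B hAB ⟨h1, c, h2⟩
    exact ⟨hAB.trans h1, c, hAB.trans h2⟩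
  have hQ : ∀ D : ℕ → Set H, (∀ k, IsOpen (D k)) → (∀ k, Dense (D k)) → ∀ k A, IsOpen A →
      A.Nonempty → ∃ B ⊆ A, IsOpen B ∧ B.Nonempty ∧ Q D k B := by
    intro D h1 h2 k A hA hAne
    obtain ⟨a, ha, haD⟩ := (h2 k).inter_open_nonempty A hA hAne
    refine ⟨A ∩ D k ∩ Metric.ball a ((1/2 : ℝ)^k), ?_, ?_, ?_, ?_, a, ?_⟩
    · exact fun x hx => hx.1.1
    · exact (hA.inter (h1 k)).inter Metric.isOpen_ball
    · exact ⟨a, ⟨ha, haD⟩, Metric.mem_ball_self (by positivity)⟩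
    · exact fun x hx => hx.1.2
    · exact fun x hx => hx.2
  have step := fun (k : ℕ) (s : State adj φ C V d x0 y0) =>
    full_step adj hconn m φ C V hV hbas d hd O hO hC hC1 hC2 x0 y0 s k
      (Q D k) (hQm D k) (hQ D hDo hDd k) (Q D' k) (hQm D' k) (hQ D' hDo' hDd' k)
  choose nx n1 n2 n3 n4 bb n5 n6 using step
  let s0 : State adj φ C V d x0 y0 :=
    { x := x0
      y := y0
      g := 1
      g' := 1
      n := 0
      k := 0
      N := 0
      hx := hx0
      hy := hy0
      hg := by simp
      hg' := by simp
      hyx := by simp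
      good := by
        intro z hz _ j _ a b hab
        obtain ⟨g, hg⟩ := hupd z j a b hab
        exact ⟨g, by rw [mem_stab]; simp [hV0], hg⟩ }
  let sq : ℕ → State adj φ C V d x0 y0 := fun k => Nat.rec s0 (fun k s => nx k s) k
  have hsq : ∀ k, sq (k+1) = nx k (sq k) := fun k => rfl
  have Wne : ∀ s : State adj φ C V d x0 y0, s.W.Nonempty := fun s =>
    ⟨d s.k * s.g, by simp [State.W, cos, (V s.n).one_mem]⟩
  have Wne' : ∀ s : State adj φ C V d x0 y0, s.W'.Nonempty := fun s => by
    exact ⟨d s.k * s.g', by simp [State.W', cos, (V s.n).one_mem]⟩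
  have Wo : ∀ s : State adj φ C V d x0 y0, IsOpen s.W := fun s =>
    (cos_open V hV d s.n s.k).preimage (continuous_id.mul continuous_const)
  have Wo' : ∀ s : State adj φ C V d x0 y0, IsOpen s.W' := fun s =>
    (cos_open V hV d s.n s.k).preimage (continuous_id.mul continuous_const)
  have Wc : ∀ s : State adj φ C V d x0 y0, IsClosed s.W := fun s =>
    (cos_closed V hV d s.n s.k).preimage (continuous_id.mul continuous_const)
  have Wc' : ∀ s : State adj φ C V d x0 y0, IsClosed s.W' := fun s =>
    (cos_closed V hV d s.n s.k).preimage (continuous_id.mul continuous_const)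
  have cantor : ∀ A : ℕ → Set H, (∀ k, IsClosed (A k)) → (∀ k, (A k).Nonempty) →
      (∀ k, A (k+1) ⊆ A k) → (∀ k, ∃ c, A k ⊆ Metric.ball c ((1/2 : ℝ)^k)) →
      (⋂ k, A k).Nonempty := by
    intro A hA1 hA2 hA3 hA4
    choose c hc using hA4
    have hanti : Antitone A := antitone_nat_of_succ_le hA3
    refine Metric.nonempty_iInter_of_nonempty_biInter hA1
      (fun k => Metric.isBounded_ball.subset (hc k)) ?_ ?_
    · intro N
      obtain ⟨a, ha⟩ := hA2 N
      exact ⟨a, by simp only [mem_iInter]; exact fun i hi => hanti hi ha⟩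
    · have hz : Tendsto (fun k : ℕ => 2 * (1/2 : ℝ)^k) atTop (𝓝 0) := by
        have := (tendsto_pow_atTop_nhds_zero_of_lt_one (r := (1/2 : ℝ)) (by norm_num)
          (by norm_num)).const_mul 2
        simpa using this
      refine squeeze_zero (fun k => Metric.diam_nonneg) (fun k => ?_) hz
      exact (Metric.diam_mono (hc k) Metric.isBounded_ball).trans (Metric.diam_ball (by positivity))
  obtain ⟨h, hh⟩ := cantor (fun k => (sq (k+1)).W) (fun k => Wc _) (fun k => Wne _)
    (fun k => n1 (k+1) (sq (k+1))) (fun k => (n3 k (sq k)).2)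
  obtain ⟨h', hh'⟩ := cantor (fun k => (sq (k+1)).W') (fun k => Wc' _) (fun k => Wne' _)
    (fun k => n2 (k+1) (sq (k+1))) (fun k => (n4 k (sq k)).2)
  rw [mem_iInter] at hh hh'
  have gh := hDg h (mem_iInter.2 fun k => (n3 k (sq k)).1 (hh k))
  have gh' := hDg' h' (mem_iInter.2 fun k => (n4 k (sq k)).1 (hh' k))
  have heq : h • φ x0 = h' • φ y0 := by
    apply hmi
    funext i
    rw [gh i _ ⟨_, Wo _, hh i, n5 i (sq i)⟩, gh' i _ ⟨_, Wo' _, hh' i, n6 i (sq i)⟩]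
  exact ⟨h'⁻¹ * h, by rw [mul_smul, heq, inv_smul_smul]⟩

end CB

namespace CB

/-- The pair embedding of `S_∞`. -/
def pe (π : Equiv.Perm ℕ) : (ℕ → ℕ) × (ℕ → ℕ) := ((π : ℕ → ℕ), (π.symm : ℕ → ℕ))

instance permTop : TopologicalSpace (Equiv.Perm ℕ) := TopologicalSpace.induced pe inferInstance

instance permMS : MeasurableSpace (Equiv.Perm ℕ) := permNatMS

lemma pe_inducing : IsInducing pe := ⟨rfl⟩

lemma pe_closed : IsClosedEmbedding pe := by
  refine ⟨⟨pe_inducing, ?_⟩, ?_⟩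
  · intro a b h
    have := congrArg Prod.fst h
    exact Equiv.coe_fn_injective this
  · have : range pe = {p | ∀ n, p.1 (p.2 n) = n ∧ p.2 (p.1 n) = n} := by
      ext p
      constructor
      · rintro ⟨π, rfl⟩ n
        simp [pe]
      · intro h
        exact ⟨⟨p.1, p.2, fun n => (h n).2, fun n => (h n).1⟩, rfl⟩
    rw [this]
    have hev : Continuous fun q : (ℕ → ℕ) × ℕ => q.1 q.2 := by
      rw [continuous_discrete_rng]
      intro b
      have : (fun q : (ℕ → ℕ) × ℕ => q.1 q.2) ⁻¹' {b} = ⋃ k, {q | q.1 k = b ∧ q.2 = k} := by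
        ext q; simp
      rw [this]
      refine isOpen_iUnion fun k => ?_
      exact ((isOpen_discrete {b}).preimage (by fun_prop : Continuous fun q : (ℕ → ℕ) × ℕ => q.1 k)).inter
        ((isOpen_discrete {k}).preimage continuous_snd)
    simp only [ofPred_forall, ofPred_and]
    refine isClosed_iInter fun n => ?_
    refine IsClosed.inter (isClosed_eq ?_ continuous_const) (isClosed_eq ?_ continuous_const)
    · exact hev.comp (by fun_prop : Continuous fun p : (ℕ → ℕ) × (ℕ → ℕ) => (p.1, p.2 n))
    · exact hev.comp (by fun_prop : Continuous fun p : (ℕ → ℕ) × (ℕ → ℕ) => (p.2, p.1 n))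

instance : PolishSpace (Equiv.Perm ℕ) := pe_closed.polishSpace

instance : BorelSpace (Equiv.Perm ℕ) := by
  refine ⟨?_⟩
  have h1 : (inferInstance : MeasurableSpace ((ℕ → ℕ) × (ℕ → ℕ))) = borel _ := BorelSpace.measurable_eq
  change MeasurableSpace.comap pe inferInstance = _
  rw [h1]
  exact borel_comap.symm

lemma cont_ev (n : ℕ) : Continuous fun π : Equiv.Perm ℕ => π n :=
  (continuous_apply n).comp (continuous_fst.comp pe_inducing.continuous)

lemma cont_evs (n : ℕ) : Continuous fun π : Equiv.Perm ℕ => π.symm n :=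
  (continuous_apply n).comp (continuous_snd.comp pe_inducing.continuous)

lemma cont_disc {A : Type} [TopologicalSpace A] {f : A → ℕ} (h : ∀ a, ∀ᶠ b in 𝓝 a, f b = f a) :
    Continuous f := by
  rw [continuous_iff_continuousAt]
  intro a
  rw [ContinuousAt, nhds_discrete ℕ, tendsto_pure]
  exact h a

lemma ev_eq {A : Type} [TopologicalSpace A] {f : A → ℕ} (h : Continuous f) (a : A) :
    ∀ᶠ b in 𝓝 a, f b = f a := by
  have := h.continuousAt (x := a)
  rwa [ContinuousAt, nhds_discrete ℕ, tendsto_pure] at this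

instance : IsTopologicalGroup (Equiv.Perm ℕ) where
  continuous_mul := by
    rw [pe_inducing.continuous_iff]
    refine Continuous.prodMk (continuous_pi fun n => cont_disc fun a => ?_)
      (continuous_pi fun n => cont_disc fun a => ?_)
    · filter_upwards [ev_eq ((cont_ev n).comp continuous_snd) a,
        ev_eq ((cont_ev (a.2 n)).comp continuous_fst) a] with b h1 h2
      simp only [Function.comp, Equiv.Perm.coe_mul] at *
      rw [h1, h2]
    · filter_upwards [ev_eq ((cont_evs n).comp continuous_fst) a,
        ev_eq ((cont_evs (a.1.symm n)).comp continuous_snd) a] with b h1 h2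
      simp only [Function.comp] at h1 h2
      change b.2.symm (b.1.symm n) = a.2.symm (a.1.symm n)
      rw [h1, h2]
  continuous_inv := by
    rw [pe_inducing.continuous_iff]
    exact continuous_swap.comp pe_inducing.continuous

/-- Basic open subgroups. -/
def V (n : ℕ) : Subgroup (Equiv.Perm ℕ) where
  carrier := {π | ∀ i < n, π i = i}
  mul_mem' := by
    intro a b ha hb i hi
    simp only [mem_ofPred_eq] at ha hb
    rw [Equiv.Perm.mul_apply, hb i hi, ha i hi]
  one_mem' := fun i _ => rfl
  inv_mem' := by
    intro a ha i hi
    rw [Equiv.Perm.inv_eq_iff_eq, ha i hi]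

lemma V_open (n : ℕ) : IsOpen (V n : Set (Equiv.Perm ℕ)) := by
  have : (V n : Set (Equiv.Perm ℕ)) = ⋂ i ∈ Finset.range n, {π | π i = i} := by
    ext π
    simp only [mem_iInter, Finset.mem_range]
    rfl
  rw [this]
  refine isOpen_biInter_finset fun i _ => ?_
  exact (isOpen_discrete {i}).preimage (cont_ev i)

lemma V_zero : V 0 = ⊤ := by
  ext π; simp [V, ← SetLike.mem_coe]

lemma V_basis (W : Set (Equiv.Perm ℕ)) (hW : W ∈ 𝓝 (1 : Equiv.Perm ℕ)) :
    ∃ n, (V n : Set (Equiv.Perm ℕ)) ⊆ W := by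
  rw [pe_inducing.nhds_eq_comap, mem_comap] at hW
  obtain ⟨t, ht, htW⟩ := hW
  rw [nhds_prod_eq, mem_prod_iff] at ht
  obtain ⟨t1, h1, t2, h2, h12⟩ := ht
  have key : ∀ (x : ℕ → ℕ) (t : Set (ℕ → ℕ)), t ∈ 𝓝 x → ∃ n, PiNat.cylinder x n ⊆ t := by
    intro x t ht
    obtain ⟨n, hn⟩ := exists_cyl (X := fun _ => ℕ) isOpen_interior (mem_interior_iff_mem_nhds.2 ht)
    exact ⟨n, hn.trans interior_subset⟩
  obtain ⟨n1, k1⟩ := key _ _ h1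
  obtain ⟨n2, k2⟩ := key _ _ h2
  refine ⟨max n1 n2, fun π hπ => htW (h12 ⟨k1 ?_, k2 ?_⟩)⟩
  · intro i hi
    exact hπ i (lt_of_lt_of_le hi (le_max_left _ _))
  · intro i hi
    exact (V _).inv_mem hπ i (lt_of_lt_of_le hi (le_max_right _ _))

theorem core {X : ℕ → Type} [∀ j, TopologicalSpace (X j)] [∀ j, DiscreteTopology (X j)]
    [∀ j, Finite (X j)] [∀ j, Nonempty (X j)] (adj : ∀ j, X j → X j → Prop)
    (hrefl : ∀ j a, adj j a a) (hsymm : ∀ j a b, adj j a b → adj j b a)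
    (hconn : ∀ j a b, Relation.ReflTransGen (adj j) a b)
    (E : (∀ j, X j) → (∀ j, X j) → Prop)
    (hmeag : IsMeagre {p : (∀ j, X j) × (∀ j, X j) | E p.1 p.2})
    (hadj : ∀ x y, (∀ j, adj j (x j) (y j)) → E x y) :
    ¬ @ClassifiableByCountableStructures _ (borel (∀ j, X j)) E := by
  rintro ⟨Y, mY, a, hY, ha1, hamul, ham, φ, hφ, hE⟩
  letI : MeasurableSpace (∀ j, X j) := borel _
  haveI : BorelSpace (∀ j, X j) := ⟨rfl⟩
  letI : MulAction (Equiv.Perm ℕ) Y :=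
    { smul := a, one_smul := ha1, mul_smul := hamul }
  let d := TopologicalSpace.denseSeq (Equiv.Perm ℕ)
  have hact : Measurable fun p : Equiv.Perm ℕ × Y => p.1 • p.2 := ham
  have hm := MeasurableSpace.measurable_mapNatBool Y
  have hmi := MeasurableSpace.injective_mapNatBool Y
  obtain ⟨C, O, hC0, hO, hC, hC1, hC2⟩ := lemmaB adj hrefl hsymm (MeasurableSpace.mapNatBool Y)
    hm hmi hact φ hφ (fun x y h => (hE x y).1 (hadj x y h)) (stab V d) (stab_open V V_open d)
  have hall : ∀ x ∈ C, ∀ y ∈ C, E x y := by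
    intro x hx y hy
    rw [hE]
    refine fusion adj hconn (MeasurableSpace.mapNatBool Y) hmi φ C V V_open V_zero V_basis d
      (TopologicalSpace.denseRange_denseSeq _) O hO hC hC1 hC2 ?_ x y hx hy
    intro z j p q hpq
    have := (hE (Function.update z j p) (Function.update z j q)).1 (hadj _ _ (fun k => ?_))
    · obtain ⟨g, hg⟩ := this
      exact ⟨g, hg.symm⟩
    · by_cases hk : k = j
      · subst hk; simpa using hpq
      · simpa [hk] using hrefl _ _
  have h1 := tendsto_residual_of_isOpenMap (continuous_fst (X := ∀ j, X j) (Y := ∀ j, X j)) isOpenMap_fst hC0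
  have h2 := tendsto_residual_of_isOpenMap (continuous_snd (X := ∀ j, X j) (Y := ∀ j, X j)) isOpenMap_snd hC0
  have h3 := inter_mem (inter_mem (mem_map.1 h1) (mem_map.1 h2)) hmeag
  obtain ⟨p, ⟨hp1, hp2⟩, hp3⟩ := (dense_of_mem_residual h3).nonempty
  exact hp3 (hall _ hp1 _ hp2)

end CB

namespace CB

lemma chain_reach {A : Type} (R : A → A → Prop) (l : List A) : ∀ c, List.IsChain R (c :: l) →
    ∀ b ∈ c :: l, Relation.ReflTransGen R c b := by
  induction l with
  | nil => intro c _ b hb; simp at hb; subst hb; exact .refl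
  | cons e l ih =>
    intro c h b hb
    rw [List.isChain_cons_cons] at h
    rcases List.mem_cons.1 hb with rfl | hb
    · exact .refl
    · exact .head h.1 (ih e h.2 b hb)

lemma chain_conn {A : Type} (R : A → A → Prop) (hR : ∀ a b, R a b → R b a) (l : List A)
    (h : List.IsChain R l) (a b : A) (ha : a ∈ l) (hb : b ∈ l) : Relation.ReflTransGen R a b := by
  cases l with
  | nil => simp at ha
  | cons c l =>
    have h1 := chain_reach R l c h a ha
    have h2 := chain_reach R l c h b hb
    have hs : Std.Symm R := ⟨hR⟩
    exact Relation.ReflTransGen.trans (Relation.ReflTransGen.stdSymm.symm _ _ h1) h2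

theorem Zcase (Z : ℕ → Type) (_ : ∀ m, MetricSpace (Z m)) (_ : ∀ m, Fintype (Z m))
    (_ : ∀ m, Nonempty (Z m)) (hZ : NontrivialFMS Z)
    (E : (∀ m, Z m) → (∀ m, Z m) → Prop)
    (hmeag : IsMeagre {p : (∀ m, Z m) × (∀ m, Z m) | E p.1 p.2})
    (hsub : ∀ x y : ∀ m, Z m, EsubZ Z x y → E x y) :
    ¬ @ClassifiableByCountableStructures _ (borel (∀ m, Z m)) E := by
  classical
  let P : ℕ → ℕ → Prop := fun m n => ∃ l : List (Z m),
    (∀ z : Z m, z ∈ l) ∧ l.IsChain (fun a b => dist a b < 1 / ((n : ℝ) + 1))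
  let adj : ∀ m, Z m → Z m → Prop := fun m a b =>
    ∀ n ≤ m, P m n → dist a b < 1 / ((n : ℝ) + 1)
  have hs : ∀ j a b, adj j a b → adj j b a := by
    intro j a b h n hn hP
    rw [dist_comm]
    exact h n hn hP
  refine core adj ?_ hs ?_ E hmeag ?_
  · intro j a n _ _
    rw [dist_self]
    positivity
  · intro j a b
    by_cases hex : ∃ n ≤ j, P j n
    · obtain ⟨n, hn, hP⟩ := hex
      have hP0 : P j (Nat.findGreatest (P j) j) := Nat.findGreatest_spec hn hP
      obtain ⟨l, hl, hch⟩ := hP0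
      refine chain_conn (adj j) (hs j) l (hch.imp ?_) a b (hl a) (hl b)
      intro p q hpq k hk hPk
      refine hpq.trans_le ?_
      have : k ≤ Nat.findGreatest (P j) j := Nat.le_findGreatest hk hPk
      exact one_div_le_one_div_of_le (by positivity) (by exact_mod_cast Nat.succ_le_succ this)
    · refine .single fun n hn hP => (hex ⟨n, hn, hP⟩).elim
  · intro x y h
    apply hsub
    rw [EsubZ, Metric.tendsto_atTop]
    intro ε hε
    obtain ⟨n, hn⟩ := exists_nat_one_div_lt hε
    have h1 := hZ.2 (1 / ((n : ℝ) + 1)) (by positivity)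
    obtain ⟨N, hN⟩ := eventually_atTop.1 h1
    refine ⟨max N n, fun m hm => ?_⟩
    rw [Real.dist_0_eq_abs, abs_of_nonneg dist_nonneg]
    exact (h m n (le_trans (le_max_right _ _) hm) (hN m (le_trans (le_max_left _ _) hm))).trans hn

end CB

namespace CB

lemma theta_finset {Θ : Set ℕ → ℝ≥0∞} (hΘ : IsTallLscSubmeasure Θ) (F : Finset ℕ) :
    Θ (F : Set ℕ) ≤ ∑ n ∈ F, Θ {n} := by
  classical
  induction F using Finset.induction_on with
  | empty => simp [hΘ.empty]
  | insert a s ha ih =>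
    rw [Finset.sum_insert ha, Finset.coe_insert, Set.insert_eq]
    exact (hΘ.subadd _ _).trans (add_le_add le_rfl ih)

lemma theta_tail {Θ : Set ℕ → ℝ≥0∞} (hΘ : IsTallLscSubmeasure Θ) (lev : ℕ → ℕ)
    (h0 : ∀ n, lev n ≠ 0 → Θ {n} ≤ 2⁻¹ ^ lev n) (l : ℕ) (hl : l ≠ 0) (A : Set ℕ)
    (hA : ∀ n ∈ A, l ≤ lev n) (hinj : InjOn lev A) : Θ A ≤ 2⁻¹ ^ l * 2 := by
  classical
  refine le_of_tendsto (hΘ.lsc A) (Eventually.of_forall fun m => ?_)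
  have hfin : (A ∩ Iio m).Finite := (finite_Iio m).subset inter_subset_right
  obtain ⟨F, hF⟩ := hfin.exists_finset_coe
  have hFA : ∀ n ∈ F, n ∈ A := fun n hn => by
    have : n ∈ A ∩ Iio m := hF ▸ (Finset.mem_coe.2 hn)
    exact this.1
  rw [← hF]
  calc Θ (F : Set ℕ) ≤ ∑ n ∈ F, Θ {n} := theta_finset hΘ F
    _ ≤ ∑ n ∈ F, (2⁻¹ : ℝ≥0∞) ^ l * 2⁻¹ ^ (lev n - l) := by
        refine Finset.sum_le_sum fun n hn => ?_
        have := hA n (hFA n hn)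
        rw [← pow_add, Nat.add_sub_cancel' this]
        exact h0 n (by omega)
    _ = 2⁻¹ ^ l * ∑ n ∈ F, (2⁻¹ : ℝ≥0∞) ^ (lev n - l) := by rw [Finset.mul_sum]
    _ = 2⁻¹ ^ l * ∑ i ∈ F.image (fun n => lev n - l), (2⁻¹ : ℝ≥0∞) ^ i := by
        rw [Finset.sum_image]
        intro a ha b hb hab
        have h1 := hA a (hFA a ha)
        have h2 := hA b (hFA b hb)
        simp only at hab
        exact hinj (hFA a ha) (hFA b hb) (by omega)
    _ ≤ 2⁻¹ ^ l * ∑' i : ℕ, (2⁻¹ : ℝ≥0∞) ^ i := by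
        gcongr
        exact ENNReal.sum_le_tsum _
    _ = 2⁻¹ ^ l * 2 := by
        rw [ENNReal.tsum_geometric, ENNReal.one_sub_inv_two, inv_inv]

lemma exists_lev {Θ : Set ℕ → ℝ≥0∞} (hΘ : IsTallLscSubmeasure Θ) : ∃ lev : ℕ → ℕ,
    (∀ n, lev n ≠ 0 → Θ {n} ≤ 2⁻¹ ^ lev n) ∧ ∀ l, ∃ N, ∀ n ≥ N, l ≤ lev n := by
  classical
  refine ⟨fun n => Nat.findGreatest (fun l => Θ {n} ≤ 2⁻¹ ^ l) n, ?_, ?_⟩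
  · intro n hn
    exact Nat.findGreatest_of_ne_zero rfl hn
  · intro l
    have h1 : ∀ᶠ n in atTop, Θ {n} < 2⁻¹ ^ l :=
      hΘ.tall.eventually_lt_const (ENNReal.pow_pos (by simp) l)
    obtain ⟨N, hN⟩ := eventually_atTop.1 h1
    refine ⟨max N l, fun n hn => ?_⟩
    exact Nat.le_findGreatest (le_trans (le_max_right _ _) hn)
      (hN n (le_trans (le_max_left _ _) hn)).le

/-- Differing in at most one coordinate. -/
def Ham {ι : Type} (a b : ι → Bool) : Prop := ∀ p q, a p ≠ b p → a q ≠ b q → p = q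

lemma ham_conn {ι : Type} [Finite ι] (a b : ι → Bool) : Relation.ReflTransGen Ham a b := by
  classical
  have := Fintype.ofFinite ι
  have key : ∀ s : Finset ι, Relation.ReflTransGen Ham a (s.piecewise b a) := by
    intro s
    induction s using Finset.induction_on with
    | empty => simp; exact .refl
    | insert i s hi ih =>
      refine ih.tail ?_
      rw [Finset.piecewise_insert]
      intro p q hp hq
      have : ∀ r, (s.piecewise b a) r ≠ Function.update (s.piecewise b a) i (b i) r → r = i := by
        intro r hr
        by_contra h
        simp [h] at hr
      rw [this p hp, this q hq]
  simpa using key Finset.univ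

/-- Regrouping homeomorphism. -/
def regroup (lev : ℕ → ℕ) : (∀ j, ({n // lev n = j} → Bool)) ≃ₜ (ℕ → Bool) where
  toFun x n := x (lev n) ⟨n, rfl⟩
  invFun z _ p := z p.1
  left_inv x := by
    funext j p
    obtain ⟨n, rfl⟩ := p
    rfl
  right_inv z := rfl
  continuous_toFun := by
    refine continuous_pi fun n => ?_
    exact (continuous_apply _).comp (continuous_apply (lev n))
  continuous_invFun := by
    refine continuous_pi fun j => continuous_pi fun p => ?_
    exact continuous_apply _

theorem Thetacase (Θ : Set ℕ → ℝ≥0∞) (hΘ : IsTallLscSubmeasure Θ)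
    (E : (ℕ → Bool) → (ℕ → Bool) → Prop)
    (hmeag : IsMeagre {p : (ℕ → Bool) × (ℕ → Bool) | E p.1 p.2})
    (hsub : ∀ x y : ℕ → Bool, EsubTheta Θ x y → E x y) :
    ¬ ClassifiableByCountableStructures E := by
  obtain ⟨lev, h0, hlev⟩ := exists_lev hΘ
  have hfin : ∀ j, Finite {n // lev n = j} := by
    intro j
    obtain ⟨N, hN⟩ := hlev (j + 1)
    refine ((finite_Iio N).subset (t := {n | lev n = j}) fun n hn => ?_).to_subtype
    by_contra h
    have h1 := hN n (not_lt.1 h)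
    have h2 : lev n = j := hn
    omega
  let ψ := regroup lev
  have main := core (X := fun j => {n // lev n = j} → Bool) (fun j => Ham)
    (fun j a p q h => (h rfl).elim) (fun j a b h p q hp hq => h p q hp.symm hq.symm)
    (fun j a b => ham_conn a b) (fun x y => E (ψ x) (ψ y))
    (hmeag.preimage_of_isOpenMap (ψ.prodCongr ψ).continuous (ψ.prodCongr ψ).isOpenMap) ?_
  · rintro ⟨Y, mY, a, hY, ha1, hamul, ham, φ, hφ, hE⟩
    refine main ⟨Y, mY, a, hY, ha1, hamul, ham, fun x => φ (ψ x), ?_, fun x y => hE _ _⟩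
    let _ : MeasurableSpace (∀ j, ({n // lev n = j} → Bool)) := borel _
    have _ : BorelSpace (∀ j, ({n // lev n = j} → Bool)) := ⟨rfl⟩
    exact hφ.comp ψ.continuous.measurable
  · intro x y h
    apply hsub
    have hinj : InjOn lev {n | ψ x n ≠ ψ y n} := by
      intro p hp q hq hpq
      have hq' : x (lev p) ⟨q, hpq.symm⟩ ≠ y (lev p) ⟨q, hpq.symm⟩ := by
        have : ∀ j (e : lev q = j), x j ⟨q, e⟩ ≠ y j ⟨q, e⟩ := by
          intro j e
          subst e
          exact hq
        exact this _ _
      exact congrArg Subtype.val (h (lev p) ⟨p, rfl⟩ ⟨q, hpq.symm⟩ hp hq')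
    rw [EsubTheta, ENNReal.tendsto_nhds_zero]
    intro ε hε
    have ht : Tendsto (fun l : ℕ => (2⁻¹ : ℝ≥0∞) ^ l * 2) atTop (𝓝 0) := by
      have := ENNReal.Tendsto.mul_const (b := 2) (ENNReal.tendsto_pow_atTop_nhds_zero_of_lt_one
        (show (2⁻¹ : ℝ≥0∞) < 1 by simp)) (Or.inr (by simp))
      simpa using this
    obtain ⟨l, hl, hl0⟩ := ((ENNReal.tendsto_nhds_zero.1 ht ε hε).and (eventually_ne_atTop 0)).exists
    obtain ⟨N, hN⟩ := hlev l
    filter_upwards [eventually_ge_atTop N] with m hm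
    refine le_trans (theta_tail hΘ lev h0 l hl0 _ ?_ ?_) hl
    · rintro n ⟨hn, _⟩
      exact hN n (hm.trans hn)
    · exact hinj.mono fun n hn => hn.2

end CB

end Work

theorem classB_not_classifiable_by_countable_structures :
    (∀ Θ : Set ℕ → ℝ≥0∞, IsTallLscSubmeasure Θ →
      ∀ E : (ℕ → Bool) → (ℕ → Bool) → Prop, Equivalence E →
        MeasurableSet {p : (ℕ → Bool) × (ℕ → Bool) | E p.1 p.2} →
        IsMeagre {p : (ℕ → Bool) × (ℕ → Bool) | E p.1 p.2} →
        (∀ x y : ℕ → Bool, EsubTheta Θ x y → E x y) →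
        ¬ ClassifiableByCountableStructures E) ∧
    (∀ (Z : ℕ → Type) (_ : ∀ m, MetricSpace (Z m)) (_ : ∀ m, Fintype (Z m))
        (_ : ∀ m, Nonempty (Z m)),
      NontrivialFMS Z →
      ∀ E : (∀ m, Z m) → (∀ m, Z m) → Prop, Equivalence E →
        @MeasurableSet ((∀ m, Z m) × (∀ m, Z m)) (borel _) {p | E p.1 p.2} →
        IsMeagre {p : (∀ m, Z m) × (∀ m, Z m) | E p.1 p.2} →
        (∀ x y : ∀ m, Z m, EsubZ Z x y → E x y) →
        ¬ @ClassifiableByCountableStructures _ (borel (∀ m, Z m)) E) := by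
  exact ⟨fun Θ hΘ E _ _ hm hs => CB.Thetacase Θ hΘ E hm hs,
    fun Z i1 i2 i3 hZ E _ _ hm hs => CB.Zcase Z i1 i2 i3 hZ E hm hs⟩
end

section
/- Let T be a finitely uniformly branching tree and 𝐝 a uniform Borel pseudometric on [T] such that E^T_0 ⊆ F_𝐝. Then F_𝐝 is nonmeager in [T]×[T] if and only if F_𝐝 = [T]×[T]. -/
open scoped ENNReal
open scoped Pointwise

/-- The branch space `[T]` of the finitely uniformly branching tree whose branching
degree at level `n` is `ℓ n`. -/
abbrev Branches (ℓ : ℕ → ℕ) : Type := {α : ℕ → ℕ // ∀ n : ℕ, α n < ℓ n}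

/-- Concatenation `s⌢α` of a stem `s` of length `m` with a branch `α` of the tree
shifted by `m`. -/
def catB (ℓ : ℕ → ℕ) (m : ℕ) (s : ℕ → ℕ) (hs : ∀ i : ℕ, i < m → s i < ℓ i)
    (α : Branches fun n => ℓ (m + n)) : Branches ℓ :=
  ⟨fun n => if n < m then s n else α.1 (n - m), fun n => by
    by_cases h : n < m
    · simpa [h] using hs n h
    · have h2 : m + (n - m) = n := by omega
      have h3 : α.1 (n - m) < ℓ (m + (n - m)) := α.2 (n - m)
      rw [h2] at h3
      simpa [h] using h3⟩

/-- `𝐝` is a Borel pseudometric on `[T]`. -/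
structure IsBorelPseudometric {ℓ : ℕ → ℕ}
    (dd : Branches ℓ → Branches ℓ → ℝ≥0∞) : Prop where
  refl : ∀ α, dd α α = 0
  symm : ∀ α β, dd α β = dd β α
  triangle : ∀ α β γ, dd α γ ≤ dd α β + dd β γ
  borel : ∀ ε : ℝ≥0∞, 0 < ε →
    MeasurableSet {p : Branches ℓ × Branches ℓ | dd p.1 p.2 < ε}
  separable : ∀ α : Branches ℓ, ∃ D : Set (Branches ℓ), D.Countable ∧
      D ⊆ {β | dd α β < ⊤} ∧
      ∀ β : Branches ℓ, dd α β < ⊤ → ∀ ε : ℝ≥0∞, 0 < ε → ∃ γ ∈ D, dd β γ < ε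
  cauchy : ∀ (a : ℕ → Branches ℓ) (α : Branches ℓ),
      Filter.Tendsto a Filter.atTop (nhds α) →
      (∀ ε : ℝ≥0∞, 0 < ε → ∃ N : ℕ, ∀ p ≥ N, ∀ q ≥ N, dd (a p) (a q) < ε) →
      Filter.Tendsto (fun n => dd (a n) α) Filter.atTop (nhds 0)

/-- `|a - b|` in `ℝ≥0∞`, with the convention `|∞ - ∞| = 0`. -/
noncomputable def eAbsSub (a b : ℝ≥0∞) : ℝ≥0∞ := (a - b) ⊔ (b - a)

/-- The pseudometric `𝐝` on `[T]` is uniform. -/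
def IsUniformPseudometric {ℓ : ℕ → ℕ}
    (dd : Branches ℓ → Branches ℓ → ℝ≥0∞) : Prop :=
  ∀ (m : ℕ) (s t : ℕ → ℕ) (hs : ∀ i : ℕ, i < m → s i < ℓ i)
    (ht : ∀ i : ℕ, i < m → t i < ℓ i) (α β : Branches fun n => ℓ (m + n)),
    eAbsSub (dd (catB ℓ m s hs α) (catB ℓ m t ht α))
        (dd (catB ℓ m s hs β) (catB ℓ m t ht β)) < (1 / 2 : ℝ≥0∞) ^ m ∧
    eAbsSub (dd (catB ℓ m s hs α) (catB ℓ m s hs β))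
        (dd (catB ℓ m t ht α) (catB ℓ m t ht β)) < (1 / 2 : ℝ≥0∞) ^ m

section Helpers

open Filter Topology Set

/-- Easy half of the Kuratowski–Ulam theorem. -/
theorem residual_sections {X Y : Type*} [TopologicalSpace X] [TopologicalSpace Y]
    [SecondCountableTopology Y] {t : Set (X × Y)} (ht : t ∈ residual (X × Y)) :
    ∀ᶠ x in residual X, {y | (x, y) ∈ t} ∈ residual Y := by
  obtain ⟨S, hSo, hSd, hSc, hSt⟩ := mem_residual_iff.1 ht
  have key : ∀ u ∈ S, ∀ᶠ x in residual X, {y | (x, y) ∈ u} ∈ residual Y := by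
    intro u hu
    have hb := TopologicalSpace.isBasis_countableBasis Y
    have h1 : ∀ o ∈ TopologicalSpace.countableBasis Y,
        ∀ᶠ x in residual X, ∃ y ∈ o, (x, y) ∈ u := by
      intro o ho
      have hoo : IsOpen o := hb.isOpen ho
      have hone : o.Nonempty := TopologicalSpace.nonempty_of_mem_countableBasis ho
      have hEq : {x : X | ∃ y ∈ o, (x, y) ∈ u} = Prod.fst '' (u ∩ (univ ×ˢ o)) := by
        ext x
        constructor
        · rintro ⟨y, hy, hxy⟩
          exact ⟨(x, y), ⟨hxy, trivial, hy⟩, rfl⟩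
        · rintro ⟨⟨x', y⟩, ⟨hxy, -, hy⟩, rfl⟩
          exact ⟨y, hy, hxy⟩
      refine residual_of_dense_open (s := {x : X | ∃ y ∈ o, (x, y) ∈ u}) ?_ ?_
      · rw [hEq]
        exact isOpenMap_fst _ ((hSo u hu).inter (isOpen_univ.prod hoo))
      · rw [dense_iff_inter_open]
        intro V hV hVne
        obtain ⟨⟨x, y⟩, ⟨hx, hy⟩, hxy⟩ :=
          (hSd u hu).inter_open_nonempty (V ×ˢ o) (hV.prod hoo) (hVne.prod hone)
        exact ⟨x, hx, y, hy, hxy⟩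
    have h2 := (eventually_countable_ball (TopologicalSpace.countable_countableBasis Y)).2 h1
    filter_upwards [h2] with x hx
    refine residual_of_dense_open ((hSo u hu).preimage (by fun_prop : Continuous fun y : Y => (x, y))) ?_
    rw [hb.dense_iff]
    intro o ho _
    obtain ⟨y, hy, hxy⟩ := hx o ho
    exact ⟨y, hy, hxy⟩
  have h3 := (eventually_countable_ball hSc).2 key
  filter_upwards [h3] with x hx
  have h4 : ∀ᶠ y in residual Y, ∀ u ∈ S, (x, y) ∈ u := (eventually_countable_ball hSc).2 hx
  filter_upwards [h4] with y hy
  exact hSt (mem_sInter.2 hy)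

variable {ℓ : ℕ → ℕ}

theorem isClosed_branches (ℓ : ℕ → ℕ) : IsClosed {α : ℕ → ℕ | ∀ n : ℕ, α n < ℓ n} := by
  have h : {α : ℕ → ℕ | ∀ n : ℕ, α n < ℓ n} = ⋂ n, (fun α : ℕ → ℕ => α n) ⁻¹' (Iio (ℓ n)) := by
    ext α; simp
  rw [h]
  exact isClosed_iInter fun n => (isClosed_discrete _).preimage (continuous_apply n)

theorem polish_branches (ℓ : ℕ → ℕ) : PolishSpace (Branches ℓ) :=
  (isClosed_branches ℓ).polishSpace

/-- Replace the first `m` entries of `x` by those of `v`. -/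
def repl (m : ℕ) (v x : Branches ℓ) : Branches ℓ :=
  ⟨fun n => if n < m then v.1 n else x.1 n, fun n => by
    by_cases h : n < m
    · simpa [h] using v.2 n
    · simpa [h] using x.2 n⟩

theorem continuous_repl (m : ℕ) (v : Branches ℓ) : Continuous (repl m v) := by
  refine Continuous.subtype_mk (continuous_pi fun n => ?_) _
  by_cases h : n < m
  · simpa [h] using continuous_const
  · simp only [h, if_false]
    exact (continuous_apply n).comp continuous_subtype_val

theorem eventually_agree (m : ℕ) (w : Branches ℓ) :
    ∀ᶠ y in 𝓝 w, ∀ n < m, y.1 n = w.1 n := by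
  refine (eventually_all_finite (finite_Iio m)).2 fun n _ => ?_
  have hc : Continuous fun y : Branches ℓ => y.1 n :=
    (continuous_apply n).comp continuous_subtype_val
  exact hc.continuousAt.eventually (p := fun k => k = w.1 n)
    ((isOpen_discrete {w.1 n}).mem_nhds rfl)

theorem isOpenMap_repl (m : ℕ) (v : Branches ℓ) : IsOpenMap (repl m v) := by
  rw [isOpenMap_iff_nhds_le]
  intro x
  have hx : repl m x (repl m v x) = x := by
    apply Subtype.ext; funext n
    by_cases h : n < m <;> simp [repl, h]
  have h1 : Tendsto (repl m x) (𝓝 (repl m v x)) (𝓝 x) := by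
    have := (continuous_repl m x).tendsto (repl m v x)
    rwa [hx] at this
  have h2 : (repl m v ∘ repl m x) =ᶠ[𝓝 (repl m v x)] id := by
    filter_upwards [eventually_agree m (repl m v x)] with y hy
    apply Subtype.ext; funext n
    by_cases h : n < m
    · have := hy n h
      simp [repl, h] at this
      simp [repl, h, this]
    · simp [repl, h]
  calc 𝓝 (repl m v x) = map (repl m v ∘ repl m x) (𝓝 (repl m v x)) := by
        rw [Filter.map_congr h2, Filter.map_id]
    _ = map (repl m v) (map (repl m x) (𝓝 (repl m v x))) := by rw [Filter.map_map]
    _ ≤ map (repl m v) (𝓝 x) := Filter.map_mono h1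

/-- Every open neighbourhood contains arbitrarily long cylinders. -/
theorem exists_cylinder {V : Set (Branches ℓ)} {v : Branches ℓ} (hV : V ∈ 𝓝 v) (k : ℕ) :
    ∃ m ≥ k, ∀ y : Branches ℓ, repl m v y ∈ V := by
  by_contra! hcon
  have : Nonempty (Branches ℓ) := ⟨v⟩
  choose! y hy using hcon
  have ht : Tendsto (fun m => repl m v (y m)) atTop (𝓝 v) := by
    rw [tendsto_subtype_rng, tendsto_pi_nhds]
    intro n
    refine tendsto_const_nhds.congr' ?_
    filter_upwards [eventually_gt_atTop n] with m hm
    simp [repl, hm]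
  obtain ⟨m, hm1, hm2⟩ := ((ht.eventually hV).and (eventually_ge_atTop k)).exists
  exact hy m hm2 hm1

theorem uniform_repl {dd : Branches ℓ → Branches ℓ → ℝ≥0∞} (hU : IsUniformPseudometric dd)
    (m : ℕ) (v x y : Branches ℓ) (hxy : ∀ n < m, y.1 n = x.1 n) :
    dd x y ≤ dd (repl m v x) (repl m v y) + (1 / 2 : ℝ≥0∞) ^ m := by
  have h := (hU m v.1 x.1 (fun i _ => v.2 i) (fun i _ => x.2 i)
    ⟨fun n => x.1 (m + n), fun n => x.2 _⟩ ⟨fun n => y.1 (m + n), fun n => y.2 _⟩).2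
  have e1 : ∀ w z : Branches ℓ, catB ℓ m w.1 (fun i _ => w.2 i)
      ⟨fun n => z.1 (m + n), fun n => z.2 _⟩ = repl m w z := by
    intro w z
    apply Subtype.ext; funext n
    by_cases hn : n < m
    · simp [catB, repl, hn]
    · have : m + (n - m) = n := by omega
      simp [catB, repl, hn, this]
  rw [e1, e1, e1, e1] at h
  have e2 : repl m x x = x := by
    apply Subtype.ext; funext n; simp [repl]
  have e3 : repl m x y = y := by
    apply Subtype.ext; funext n
    by_cases hn : n < m
    · simp [repl, hn, hxy n hn]
    · simp [repl, hn]
  rw [e2, e3] at h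
  have h' := (le_max_right _ _).trans h.le
  exact tsub_le_iff_left.1 h'

theorem repl_finite (m : ℕ) (v x : Branches ℓ) : {n : ℕ | x.1 n ≠ (repl m v x).1 n}.Finite := by
  refine (finite_Iio m).subset fun n hn => ?_
  by_contra h
  exact hn (by simp [repl, show ¬ n < m from h])

end Helpers

open Filter Topology Set in
theorem exists_nonmeagre_section {ℓ : ℕ → ℕ} (dd : Branches ℓ → Branches ℓ → ℝ≥0∞)
    (hBP : IsBorelPseudometric dd)
    (hF : ¬ IsMeagre {p : Branches ℓ × Branches ℓ | dd p.1 p.2 < ⊤}) :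
    ∃ x, ¬ IsMeagre {y | dd x y < ⊤} := by
  have := polish_branches ℓ
  obtain ⟨O, hO, hEq⟩ := (hBP.borel ⊤ ENNReal.zero_lt_top).residualEq_isOpen
  have hEq' := Filter.eventuallyEq_set.1 hEq
  have hOne : O.Nonempty := by
    by_contra hne
    rw [not_nonempty_iff_eq_empty] at hne
    apply hF
    filter_upwards [hEq'] with p hp hp'
    simpa [hne] using hp.1 hp'
  obtain ⟨x, ⟨p, hp, rfl⟩, hx⟩ := (dense_of_mem_residual (residual_sections hEq')).inter_open_nonempty
    (Prod.fst '' O) (isOpenMap_fst O hO) (hOne.image _)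
  refine ⟨p.1, fun hm => ?_⟩
  have hsec : IsOpen {y | (p.1, y) ∈ O} :=
    hO.preimage (by fun_prop : Continuous fun y : Branches ℓ => (p.1, y))
  refine not_isMeagre_of_isOpen hsec ⟨p.2, hp⟩ ?_
  have hx' : ∀ᶠ y in residual (Branches ℓ), _ := hx
  filter_upwards [hx', hm] with y hy1 hy2 hy3
  exact hy2 (hy1.2 hy3)

open Filter Topology Set in
theorem exists_good {ℓ : ℕ → ℕ} (dd : Branches ℓ → Branches ℓ → ℝ≥0∞)
    (hBP : IsBorelPseudometric dd) (x : Branches ℓ) (hx : ¬ IsMeagre {y | dd x y < ⊤}) (k : ℕ) :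
    ∃ m ≥ k, ∃ v γ : Branches ℓ,
      ∀ᶠ y in residual (Branches ℓ), dd γ (repl m v y) < (1 / 2 : ℝ≥0∞) ^ k := by
  have := polish_branches ℓ
  have hpos : (0 : ℝ≥0∞) < (1 / 2 : ℝ≥0∞) ^ k := ENNReal.pow_pos (by simp) k
  obtain ⟨D, hDc, -, hD⟩ := hBP.separable x
  have h1 : ∃ γ ∈ D, ¬ IsMeagre {y | dd γ y < (1 / 2 : ℝ≥0∞) ^ k} := by
    by_contra! hcon
    refine hx ((isMeagre_biUnion hDc hcon).mono fun y hy => ?_)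
    obtain ⟨γ, hγ, hlt⟩ := hD y hy _ hpos
    rw [hBP.symm] at hlt
    exact mem_iUnion₂.2 ⟨γ, hγ, hlt⟩
  obtain ⟨γ, -, hγ⟩ := h1
  have hmeas : MeasurableSet {y | dd γ y < (1 / 2 : ℝ≥0∞) ^ k} :=
    (hBP.borel _ hpos).preimage (by fun_prop : Measurable fun y : Branches ℓ => (γ, y))
  obtain ⟨V, hV, hEq⟩ := hmeas.residualEq_isOpen
  have hEq' := Filter.eventuallyEq_set.1 hEq
  have hVne : V.Nonempty := by
    by_contra hne
    rw [not_nonempty_iff_eq_empty] at hne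
    apply hγ
    filter_upwards [hEq'] with p hp hp'
    simpa [hne] using hp.1 hp'
  obtain ⟨v, hv⟩ := hVne
  obtain ⟨m, hm, hcyl⟩ := exists_cylinder (hV.mem_nhds hv) k
  refine ⟨m, hm, v, γ, ?_⟩
  filter_upwards [(tendsto_residual_of_isOpenMap (continuous_repl m v)
    (isOpenMap_repl m v)).eventually hEq'] with y hy
  exact hy.2 (hcyl y)

open Filter Topology

theorem uniform_pseudometric_nonmeager_iff_everything
    (ℓ : ℕ → ℕ) (hℓ : ∀ n : ℕ, 2 ≤ ℓ n)
    (dd : Branches ℓ → Branches ℓ → ℝ≥0∞)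
    (hBP : IsBorelPseudometric dd) (hU : IsUniformPseudometric dd)
    (hE0 : ∀ α β : Branches ℓ, {n : ℕ | α.1 n ≠ β.1 n}.Finite → dd α β < ⊤) :
    ¬ IsMeagre {p : Branches ℓ × Branches ℓ | dd p.1 p.2 < ⊤} ↔
      ∀ α β : Branches ℓ, dd α β < ⊤ := by
  have := polish_branches ℓ
  have : Nonempty (Branches ℓ) := ⟨⟨fun _ => 0, fun n => lt_of_lt_of_le two_pos (hℓ n)⟩⟩
  constructor
  · intro hF
    obtain ⟨x, hx⟩ := exists_nonmeagre_section dd hBP hF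
    choose m hm v γ hg using exists_good dd hBP x hx
    have hG := eventually_countable_forall.2 hg
    have hdense := dense_of_mem_residual hG
    set G : Set (Branches ℓ) :=
      {y | ∀ k, dd (γ k) (repl (m k) (v k) y) < (1 / 2 : ℝ≥0∞) ^ k} with hGdef
    have hclose : ∀ k, ∀ a ∈ G, ∀ b ∈ G,
        dd (repl (m k) (v k) a) (repl (m k) (v k) b) < (1 / 2 : ℝ≥0∞) ^ k + (1 / 2 : ℝ≥0∞) ^ k := by
      intro k a ha b hb
      refine (hBP.triangle _ (γ k) _).trans_lt (ENNReal.add_lt_add ?_ (hb k))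
      rw [hBP.symm]
      exact ha k
    have hfinG : ∀ a ∈ G, ∀ b ∈ G, dd a b < ⊤ := by
      intro a ha b hb
      have h1 := hE0 a _ (repl_finite (m 0) (v 0) a)
      have h2 := hE0 b _ (repl_finite (m 0) (v 0) b)
      rw [hBP.symm] at h2
      refine (hBP.triangle a (repl (m 0) (v 0) a) b).trans_lt (ENNReal.add_lt_top.2 ⟨h1, ?_⟩)
      exact (hBP.triangle _ (repl (m 0) (v 0) b) b).trans_lt
        (ENNReal.add_lt_top.2 ⟨(hclose 0 a ha b hb).trans_le le_top, h2⟩)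
    have hnear : ∀ z : Branches ℓ, ∃ a ∈ G, dd a z < ⊤ := by
      intro z
      obtain ⟨a, haG, haz⟩ := mem_closure_iff_seq_limit.1 (hdense z)
      have hc := hBP.cauchy a z haz (by
        intro ε hε
        have hlim : Tendsto (fun k : ℕ => 3 * (1 / 2 : ℝ≥0∞) ^ k) atTop (𝓝 0) := by
          have h := ENNReal.Tendsto.const_mul (a := 3)
            (ENNReal.tendsto_pow_atTop_nhds_zero_of_lt_one
              (r := (1 / 2 : ℝ≥0∞)) (by simp)) (Or.inr (by simp))
          simpa using h
        obtain ⟨k, hk⟩ := (hlim.eventually (gt_mem_nhds hε)).exists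
        obtain ⟨N, hN⟩ := eventually_atTop.1 (haz.eventually (eventually_agree (m k) z))
        refine ⟨N, fun p hp q hq => lt_of_le_of_lt ?_ hk⟩
        have h1 := uniform_repl hU (m k) (v k) (a p) (a q)
          (fun n hn => (hN q hq n hn).trans (hN p hp n hn).symm)
        have h2 := (hclose k (a p) (haG p) (a q) (haG q)).le
        have h3 : (1 / 2 : ℝ≥0∞) ^ m k ≤ (1 / 2 : ℝ≥0∞) ^ k :=
          pow_le_pow_right_of_le_one' (by simp) (hm k)
        calc dd (a p) (a q) ≤ _ := h1
          _ ≤ ((1 / 2 : ℝ≥0∞) ^ k + (1 / 2 : ℝ≥0∞) ^ k) + (1 / 2 : ℝ≥0∞) ^ k := add_le_add h2 h3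
          _ = 3 * (1 / 2 : ℝ≥0∞) ^ k := by ring)
      obtain ⟨n, hn⟩ := (hc.eventually (gt_mem_nhds ENNReal.zero_lt_top)).exists
      exact ⟨a n, haG n, hn⟩
    intro α β
    obtain ⟨a, ha, haα⟩ := hnear α
    obtain ⟨b, hb, hbβ⟩ := hnear β
    rw [hBP.symm] at haα
    exact (hBP.triangle α a β).trans_lt (ENNReal.add_lt_top.2 ⟨haα,
      (hBP.triangle a b β).trans_lt (ENNReal.add_lt_top.2 ⟨hfinG a ha b hb, hbβ⟩)⟩)
  · intro h
    have hu : {p : Branches ℓ × Branches ℓ | dd p.1 p.2 < ⊤} = Set.univ :=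
      Set.eq_univ_of_forall fun p => h _ _
    rw [hu]
    exact not_isMeagre_of_isOpen isOpen_univ Set.univ_nonempty
end
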